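/- arXiv:1010.0260 — 3 statements merged into one kernel-verified Lean document; each statement's English description precedes it below -/
import Mathlib

section
/- For every h ∈ SO(3) and every x ∈ ℝ⁵, the matrix h·X(x)·h⁻¹ is again symmetric and trace-free, so it equals X(x') for a unique x' ∈ ℝ⁵, and Υ(x') = Υ(x); that is, the cubic form Υ is invariant under the conjugation action of SO(3) on S²₀(ℝ³) ≅ ℝ⁵. -/
open Matrix

/-- The identification `ℝ⁵ ≅ S²₀(ℝ³)`, `x ↦ X(x)`. -/
noncomputable def Xmat (x : Fin 5 → ℝ) : Matrix (Fin 3) (Fin 3) ℝ :=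
  !![x 0 / Real.sqrt 3 - x 4, x 3, x 1;
     x 3, x 0 / Real.sqrt 3 + x 4, x 2;
     x 1, x 2, -2 * x 0 / Real.sqrt 3]

/-- The homogeneous cubic form `Υ` on `ℝ⁵`. -/
noncomputable def Upsilon (x : Fin 5 → ℝ) : ℝ :=
  x 0 ^ 3 + (3 / 2) * x 0 * (x 1 ^ 2 + x 2 ^ 2 - 2 * x 3 ^ 2 - 2 * x 4 ^ 2)
    + (3 * Real.sqrt 3 / 2) * (x 1 ^ 2 - x 2 ^ 2) * x 4
    - 3 * Real.sqrt 3 * x 1 * x 2 * x 3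

/-- `h` is a real `3×3` orthogonal matrix of determinant one, i.e. an element of `SO(3)`. -/
def IsSO3 (h : Matrix (Fin 3) (Fin 3) ℝ) : Prop := hᵀ * h = 1 ∧ h.det = 1

theorem Xmat_isSymm (x : Fin 5 → ℝ) : (Xmat x).IsSymm := by
  ext i j
  fin_cases i <;> fin_cases j <;> simp [Xmat]

theorem Xmat_trace (x : Fin 5 → ℝ) : (Xmat x).trace = 0 := by
  simp [Xmat, Matrix.trace_fin_three]
  ring

theorem Xmat_injective : Function.Injective Xmat := by
  intro x y hxy
  have h3 : Real.sqrt 3 ≠ 0 := by positivity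
  have h00 := congrFun (congrFun hxy 0) 0
  have h01 := congrFun (congrFun hxy 0) 1
  have h02 := congrFun (congrFun hxy 0) 2
  have h12 := congrFun (congrFun hxy 1) 2
  have h22 := congrFun (congrFun hxy 2) 2
  simp [Xmat] at h00 h01 h02 h12 h22
  have h0 : x 0 = y 0 := by
    simpa [div_left_inj' h3] using h22
  have h4 : x 4 = y 4 := by
    rw [h0] at h00
    linarith
  ext i
  fin_cases i <;> assumption

/-- Every symmetric trace-free matrix is in the range of `Xmat`. -/
theorem exists_Xmat_eq {M : Matrix (Fin 3) (Fin 3) ℝ} (hM : M.IsSymm) (htr : M.trace = 0) :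
    ∃ x, Xmat x = M := by
  have h3 : Real.sqrt 3 ≠ 0 := by positivity
  rw [Matrix.trace_fin_three] at htr
  refine ⟨![-(Real.sqrt 3 * M 2 2) / 2, M 0 2, M 1 2, M 0 1, (M 1 1 - M 0 0) / 2], ?_⟩
  have h10 := hM.apply 0 1
  have h20 := hM.apply 0 2
  have h21 := hM.apply 1 2
  ext i j
  fin_cases i <;> fin_cases j <;> simp [Xmat, h10, h20, h21] <;> field_simp <;> linarith

theorem Upsilon_eq_det (x : Fin 5 → ℝ) :
    Upsilon x = -(3 * Real.sqrt 3 / 2) * (Xmat x).det := by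
  obtain ⟨a, ha⟩ : ∃ a, x 0 = Real.sqrt 3 * a :=
    ⟨x 0 / Real.sqrt 3, by field_simp⟩
  have h3 : Real.sqrt 3 ^ 2 = 3 := Real.sq_sqrt (by norm_num)
  have hdiv : x 0 / Real.sqrt 3 = a := by
    rw [ha]
    field_simp
  have hX : Xmat x = !![a - x 4, x 3, x 1; x 3, a + x 4, x 2; x 1, x 2, -2 * a] := by
    rw [Xmat, mul_div_assoc, hdiv]
  rw [hX, Matrix.det_fin_three, Upsilon, ha]
  simp
  linear_combination (Real.sqrt 3 * a ^ 3) * h3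

/-- `Υ` is invariant under the conjugation action of `SO(3)` on `S²₀(ℝ³) ≅ ℝ⁵`:
`h·X(x)·h⁻¹` is symmetric trace-free, hence equals `X(x')` for a unique `x'`, and
`Υ(x') = Υ(x)`. -/
theorem Upsilon_SO3_invariant (h : Matrix (Fin 3) (Fin 3) ℝ) (hh : IsSO3 h)
    (x : Fin 5 → ℝ) :
    (h * Xmat x * h⁻¹).IsSymm ∧ (h * Xmat x * h⁻¹).trace = 0 ∧
    (∃! x' : Fin 5 → ℝ, Xmat x' = h * Xmat x * h⁻¹) ∧
    (∀ x' : Fin 5 → ℝ, Xmat x' = h * Xmat x * h⁻¹ → Upsilon x' = Upsilon x) := by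
  have hinv : h⁻¹ = hᵀ := Matrix.inv_eq_left_inv hh.1
  have hunit : IsUnit h := (Matrix.isUnit_iff_isUnit_det h).2 (by simp [hh.2])
  have hsymm : (h * Xmat x * h⁻¹).IsSymm := by
    rw [Matrix.IsSymm, hinv, Matrix.transpose_mul, Matrix.transpose_mul,
      Matrix.transpose_transpose, (Xmat_isSymm x).eq, Matrix.mul_assoc]
  have htr : (h * Xmat x * h⁻¹).trace = 0 := by
    rw [Matrix.trace_mul_cycle, hinv, hh.1, Matrix.one_mul, Xmat_trace]
  obtain ⟨y, hy⟩ := exists_Xmat_eq hsymm htr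
  refine ⟨hsymm, htr, ⟨y, hy, fun z hz => Xmat_injective (hz.trans hy.symm)⟩, fun z hz => ?_⟩
  rw [Upsilon_eq_det, Upsilon_eq_det, hz, Matrix.det_conj hunit]
end

section
/- Let T be the symmetric trilinear form on ℝ⁵ obtained by polarizing Υ, i.e. the unique symmetric trilinear map with T(x,x,x) = Υ(x) for all x. For v ∈ ℝ⁵ define the endomorphism Υ_v of ℝ⁵ by ⟨Υ_v(u), w⟩ = T(v,u,w). Then for every v ∈ ℝ⁵: (a) Υ_v is symmetric: ⟨Υ_v(u), w⟩ = ⟨u, Υ_v(w)⟩ for all u,w; (b) Υ_v is trace-free: tr(Υ_v) = 0; and (c) Υ_v reconstructs the metric: Υ_v(Υ_v(v)) = ⟨v,v⟩·v. -/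
open Matrix

/-- The polarization of `Υ`: the symmetric trilinear form with `T(x,x,x) = Υ(x)`. -/
noncomputable def Tpol (u v w : Fin 5 → ℝ) : ℝ :=
  (1 / 6) * (Upsilon (u + v + w) - Upsilon (u + v) - Upsilon (u + w) - Upsilon (v + w)
    + Upsilon u + Upsilon v + Upsilon w)

/-- The coordinates of `Υ_v(u)`, that is, of the gradient in `w` of `T(v, u, w)`. -/
noncomputable def UpsilonEnd (v u : Fin 5 → ℝ) : Fin 5 → ℝ :=
  ![v 0 * u 0 + (1 / 2) * (v 1 * u 1 + v 2 * u 2) - v 3 * u 3 - v 4 * u 4,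
    (1 / 2) * (v 0 * u 1 + v 1 * u 0)
      + (Real.sqrt 3 / 2) * (v 1 * u 4 + v 4 * u 1 - v 2 * u 3 - v 3 * u 2),
    (1 / 2) * (v 0 * u 2 + v 2 * u 0)
      - (Real.sqrt 3 / 2) * (v 2 * u 4 + v 4 * u 2 + v 1 * u 3 + v 3 * u 1),
    -(v 0 * u 3 + v 3 * u 0) - (Real.sqrt 3 / 2) * (v 1 * u 2 + v 2 * u 1),
    -(v 0 * u 4 + v 4 * u 0) + (Real.sqrt 3 / 2) * (v 1 * u 1 - v 2 * u 2)]

theorem UpsilonEnd_dotProduct (v u w : Fin 5 → ℝ) :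
    UpsilonEnd v u ⬝ᵥ w = Tpol v u w := by
  simp [UpsilonEnd, Tpol, Upsilon, dotProduct, Fin.sum_univ_five]
  ring

theorem UpsilonEnd_dotProduct_comm (v u w : Fin 5 → ℝ) :
    UpsilonEnd v u ⬝ᵥ w = u ⬝ᵥ UpsilonEnd v w := by
  simp [UpsilonEnd, dotProduct, Fin.sum_univ_five]
  ring

theorem sum_UpsilonEnd_single (v : Fin 5 → ℝ) :
    ∑ i : Fin 5, UpsilonEnd v (Pi.single i 1) i = 0 := by
  simp [UpsilonEnd, Fin.sum_univ_five, Pi.single_apply]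
  ring

theorem UpsilonEnd_UpsilonEnd_self (v : Fin 5 → ℝ) :
    UpsilonEnd v (UpsilonEnd v v) = (v ⬝ᵥ v) • v := by
  have h : Real.sqrt 3 ^ 2 = 3 := Real.sq_sqrt (by norm_num)
  ext i
  fin_cases i <;> simp [UpsilonEnd, dotProduct, Fin.sum_univ_five] <;> ring_nf <;>
    rw [h] <;> ring

/-- For `v ∈ ℝ⁵`, any endomorphism `Υ_v` of `ℝ⁵` with `⟨Υ_v(u), w⟩ = T(v,u,w)` is
symmetric, trace-free, and reconstructs the metric: `Υ_v(Υ_v(v)) = ⟨v,v⟩·v`. -/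
theorem Upsilon_v_symm_tracefree_reconstructs (v : Fin 5 → ℝ)
    (Uv : (Fin 5 → ℝ) → (Fin 5 → ℝ))
    (hUv : ∀ u w : Fin 5 → ℝ, Uv u ⬝ᵥ w = Tpol v u w) :
    (∀ u w : Fin 5 → ℝ, Uv u ⬝ᵥ w = u ⬝ᵥ Uv w) ∧
    (∑ i : Fin 5, Uv (Pi.single i 1) i) = 0 ∧
    Uv (Uv v) = (v ⬝ᵥ v) • v := by
  have hU : Uv = UpsilonEnd v := by
    ext1 u
    exact dotProduct_eq _ _ fun w => (hUv u w).trans (UpsilonEnd_dotProduct v u w).symm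
  subst hU
  exact ⟨UpsilonEnd_dotProduct_comm v, sum_UpsilonEnd_single v, UpsilonEnd_UpsilonEnd_self v⟩
end

section
/- Let i_st : SO(3) → SO(5) be the standard embedding A ↦ diag(A, 1, 1) (block diagonal). For every continuous map f : S⁴ → SO(3) from the 4-sphere, the composition i_st ∘ f : S⁴ → SO(5) is null-homotopic, i.e. homotopic to a constant map. (Equivalently, the induced homomorphism (i_st)_* : π₄(SO(3)) → π₄(SO(5)) is trivial.) -/
open Matrix

/-- `SO(n)`: real `n×n` orthogonal matrices of determinant one, with the subspace
topology from the space of matrices. -/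
abbrev SO (n : ℕ) : Type :=
  {A : Matrix (Fin n) (Fin n) ℝ // Aᵀ * A = 1 ∧ A.det = 1}

/-- The 4-sphere, as the unit sphere in `ℝ⁵`. -/
abbrev S4 : Type := Metric.sphere (0 : EuclideanSpace ℝ (Fin 5)) 1

/-- The standard embedding `SO(3) → SO(5)`, `A ↦ diag(A, 1, 1)`. -/
def ist (A : Matrix (Fin 3) (Fin 3) ℝ) : Matrix (Fin 5) (Fin 5) ℝ :=
  Matrix.of fun i j =>
    if hi : (i : ℕ) < 3 then
      (if hj : (j : ℕ) < 3 then A ⟨i, hi⟩ ⟨j, hj⟩ else 0)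
    else (if (i : ℕ) = (j : ℕ) then 1 else 0)

open Quaternion Topology

/-- A property of continuous maps out of a compact space that is invariant under small
perturbations, uniformly controlled by a neighbourhood `U` of the diagonal, is invariant under
homotopy. -/
theorem ContinuousMap.Homotopic.induction_of_close {α B : Type*} [TopologicalSpace α]
    [CompactSpace α] [TopologicalSpace B] (P : C(α, B) → Prop) (U : Set (B × B))
    (hU : ∀ b, U ∈ 𝓝 (b, b))
    (hP : ∀ b b' : C(α, B), (∀ x, (b x, b' x) ∈ U) → P b → P b')
    {b₀ b₁ : C(α, B)} (h : ContinuousMap.Homotopic b₀ b₁) (h₀ : P b₀) : P b₁ := by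
  obtain ⟨H⟩ := h
  have key : IsLocallyConstant (fun t : unitInterval => P (H.curry t)) := by
    rw [IsLocallyConstant.iff_eventually_eq]
    intro t
    have h1 : ∀ᶠ s in 𝓝 t, ∀ x ∈ (Set.univ : Set α), (H (t, x), H (s, x)) ∈ U := by
      refine isCompact_univ.eventually_forall_of_forall_eventually fun x _ => ?_
      have : Filter.Tendsto (fun z : unitInterval × α => (H (t, z.2), H (z.1, z.2)))
          (𝓝 (t, x)) (𝓝 (H (t, x), H (t, x))) :=
        ((H.continuous.comp (by fun_prop : Continuous fun z : unitInterval × α => (t, z.2))).prodMk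
          H.continuous).tendsto' _ _ rfl
      exact this (hU _)
    have h2 : ∀ᶠ s in 𝓝 t, ∀ x ∈ (Set.univ : Set α), (H (s, x), H (t, x)) ∈ U := by
      refine isCompact_univ.eventually_forall_of_forall_eventually fun x _ => ?_
      have : Filter.Tendsto (fun z : unitInterval × α => (H (z.1, z.2), H (t, z.2)))
          (𝓝 (t, x)) (𝓝 (H (t, x), H (t, x))) :=
        (H.continuous.prodMk (H.continuous.comp
          (by fun_prop : Continuous fun z : unitInterval × α => (t, z.2)))).tendsto' _ _ rfl
      exact this (hU _)
    filter_upwards [h1, h2] with s hs1 hs2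
    exact propext ⟨hP _ _ fun x => hs2 x trivial, hP _ _ fun x => hs1 x trivial⟩
  have h01 := key.apply_eq_of_preconnectedSpace 0 1
  have e0 : H.curry 0 = b₀ := by ext x; simp
  have e1 : H.curry 1 = b₁ := by ext x; simp
  rw [e0, e1] at h01
  exact h01 ▸ h₀

section Sphere

variable {V : Type*} [NormedAddCommGroup V]

/-- The fold of the unit sphere of `V × ℝ` onto one of its hemispheres. -/
def foldSphere (σ : ℝ) (hσ : |σ| = 1) :
    C(Metric.sphere (0 : V × ℝ) 1, Metric.sphere (0 : V × ℝ) 1) where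
  toFun x := ⟨(x.1.1, σ * |x.1.2|), by
    have := mem_sphere_zero_iff_norm.1 x.2
    rw [Prod.norm_def] at this
    simpa [Prod.norm_def, abs_mul, hσ] using this⟩
  continuous_toFun := by fun_prop

theorem foldSphere_one_of_nonneg {x : Metric.sphere (0 : V × ℝ) 1} (hx : 0 ≤ x.1.2) :
    foldSphere 1 (by simp) x = x := by
  ext1
  simp [foldSphere, abs_of_nonneg hx]

theorem foldSphere_neg_one_of_nonpos {x : Metric.sphere (0 : V × ℝ) 1} (hx : x.1.2 ≤ 0) :
    foldSphere (-1) (by simp) x = x := by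
  ext1
  simp [foldSphere, abs_of_nonpos hx]

/-- The inclusion of the equator. -/
def equator : C(Metric.sphere (0 : V) 1, Metric.sphere (0 : V × ℝ) 1) where
  toFun y := ⟨(y.1, 0), by simp [Prod.norm_def]⟩
  continuous_toFun := by fun_prop

/-- Maps on the two hemispheres that agree on the equator glue. -/
theorem exists_glue_hemispheres {E : Type*} [TopologicalSpace E]
    (p m : C(Metric.sphere (0 : V × ℝ) 1, E)) (h : ∀ y, p (equator y) = m (equator y)) :
    ∃ e : C(Metric.sphere (0 : V × ℝ) 1, E),
      (∀ x, 0 ≤ x.1.2 → e x = p x) ∧ ∀ x, x.1.2 ≤ 0 → e x = m x := by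
  have hpm : ∀ x : Metric.sphere (0 : V × ℝ) 1, x.1.2 = 0 → p x = m x := by
    intro x hx
    have hx1 := mem_sphere_zero_iff_norm.1 x.2
    rw [Prod.norm_def] at hx1
    have hy : x.1.1 ∈ Metric.sphere (0 : V) 1 := by
      simpa [hx] using hx1
    have : x = equator ⟨x.1.1, hy⟩ := by
      ext1
      exact Prod.ext rfl hx
    rw [this, h]
  refine ⟨⟨fun x => if 0 ≤ x.1.2 then p x else m x, ?_⟩, ?_, ?_⟩
  · refine Continuous.if_le p.continuous m.continuous (by fun_prop) (by fun_prop) ?_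
    intro x hx
    exact hpm x hx.symm
  · intro x hx
    simp [hx]
  · intro x hx
    rcases hx.lt_or_eq with h' | h'
    · simp [not_le.2 h']
    · simp [h', hpm x h']

variable [NormedSpace ℝ V]

theorem inv_norm_smul_mem_sphere {v : V} (hv : v ≠ 0) :
    ‖v‖⁻¹ • v ∈ Metric.sphere (0 : V) 1 := by
  simp [norm_smul, hv]

/-- Radial projection of a nowhere vanishing map to the unit sphere. -/
noncomputable def toSphere {X : Type*} [TopologicalSpace X] (F : C(X, V)) (hF : ∀ x, F x ≠ 0) :
    C(X, Metric.sphere (0 : V) 1) where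
  toFun x := ⟨‖F x‖⁻¹ • F x, inv_norm_smul_mem_sphere (hF x)⟩
  continuous_toFun := by
    have : ∀ x, ‖F x‖ ≠ 0 := fun x => norm_ne_zero_iff.2 (hF x)
    fun_prop (disch := assumption)

/-- The degree one homogeneous extension of a (parametrised) map on the unit sphere. -/
noncomputable def coneExt {T F : Type*} [NormedAddCommGroup F] [NormedSpace ℝ F]
    (u : T × Metric.sphere (0 : V) 1 → F) (p : T × V) : F :=
  open Classical in
  if hv : p.2 = 0 then 0 else ‖p.2‖ • u (p.1, ⟨‖p.2‖⁻¹ • p.2, inv_norm_smul_mem_sphere hv⟩)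

section coneExt

variable {T F : Type*} [NormedAddCommGroup F] [NormedSpace ℝ F]
  (u : T × Metric.sphere (0 : V) 1 → F)

theorem coneExt_zero (t : T) : coneExt u (t, 0) = 0 := by simp [coneExt]

theorem coneExt_of_ne {v : V} (hv : v ≠ 0) (t : T) :
    coneExt u (t, v) = ‖v‖ • u (t, ⟨‖v‖⁻¹ • v, inv_norm_smul_mem_sphere hv⟩) := by
  simp [coneExt, hv]

theorem coneExt_coe (t : T) (x : Metric.sphere (0 : V) 1) : coneExt u (t, x) = u (t, x) := by
  have hx : ‖(x : V)‖ = 1 := by simp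
  have h0 : (x : V) ≠ 0 := norm_ne_zero_iff.1 (by simp)
  rw [coneExt_of_ne u h0]
  simp [hx]

theorem coneExt_smul (t : T) {c : ℝ} (hc : 0 ≤ c) (v : V) :
    coneExt u (t, c • v) = c • coneExt u (t, v) := by
  rcases hc.eq_or_lt with rfl | hc
  · simp [coneExt_zero]
  by_cases hv : v = 0
  · simp [hv, coneExt_zero]
  have hcv : c • v ≠ 0 := smul_ne_zero hc.ne' hv
  rw [coneExt_of_ne u hcv, coneExt_of_ne u hv]
  have : ‖c • v‖⁻¹ • c • v = ‖v‖⁻¹ • v := by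
    rw [norm_smul, Real.norm_of_nonneg hc.le, mul_inv, smul_smul]
    congr 1
    field_simp
  simp only [this]
  refine Eq.trans ?_ (mul_smul c ‖v‖ _)
  congr 1
  rw [norm_smul, Real.norm_of_nonneg hc.le]

theorem continuous_coneExt [TopologicalSpace T] [CompactSpace T] [ProperSpace V]
    (hu : Continuous u) : Continuous (coneExt u) := by
  obtain ⟨C, hC⟩ : ∃ C, ∀ p, ‖u p‖ ≤ C := by
    obtain ⟨C, hC⟩ := (isCompact_range hu).isBounded.exists_norm_le
    exact ⟨C, fun p => hC _ ⟨p, rfl⟩⟩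
  rw [continuous_iff_continuousAt]
  rintro ⟨t, v⟩
  by_cases hv : v = 0
  · subst hv
    rw [ContinuousAt, coneExt_zero]
    refine squeeze_zero_norm (a := fun p : T × V => ‖p.2‖ * C) ?_ ?_
    · rintro ⟨s, w⟩
      by_cases hw : w = 0
      · simp [hw, coneExt_zero]
      · rw [coneExt_of_ne u hw, norm_smul, norm_norm]
        exact mul_le_mul_of_nonneg_left (hC _) (norm_nonneg _)
    · exact (show Continuous fun p : T × V => ‖p.2‖ * C by fun_prop).tendsto' _ _ (by simp)
  · have hop : IsOpen {p : T × V | p.2 ≠ 0} := isOpen_ne_fun (by fun_prop) (by fun_prop)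
    refine ContinuousOn.continuousAt (s := {p : T × V | p.2 ≠ 0}) ?_ (hop.mem_nhds hv)
    rw [continuousOn_iff_continuous_domRestrict]
    have : Set.domRestrict {p : T × V | p.2 ≠ 0} (coneExt u) = fun p =>
        ‖p.1.2‖ • u (p.1.1, ⟨‖p.1.2‖⁻¹ • p.1.2, inv_norm_smul_mem_sphere p.2⟩) := by
      funext p
      exact coneExt_of_ne u p.2 _
    rw [this]
    have hne : ∀ p : {p : T × V | p.2 ≠ 0}, ‖p.1.2‖ ≠ 0 := fun p => norm_ne_zero_iff.2 p.2
    refine Continuous.smul (by fun_prop) (hu.comp ?_)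
    fun_prop (disch := assumption)

end coneExt

theorem foldSphere_homotopic_const (σ : ℝ) (hσ : |σ| = 1) :
    ∃ y, (foldSphere (V := V) σ hσ).Homotopic (.const _ y) := by
  have hσ0 : σ ≠ 0 := by rintro rfl; simp at hσ
  let F : C(unitInterval × Metric.sphere (0 : V × ℝ) 1, V × ℝ) :=
    ⟨fun p => ((1 - (p.1 : ℝ)) • p.2.1.1, σ * ((1 - p.1) * |p.2.1.2| + p.1)), by fun_prop⟩
  have hF : ∀ p, F p ≠ 0 := by
    rintro ⟨t, x⟩ h
    have ht0 := t.2.1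
    have ht1 := t.2.2
    have h1 : (1 - (t : ℝ)) • x.1.1 = 0 := congrArg Prod.fst h
    have h2 : σ * ((1 - (t : ℝ)) * |x.1.2| + t) = 0 := congrArg Prod.snd h
    have h3 : (1 - (t : ℝ)) * |x.1.2| + t = 0 := by simpa [hσ0] using h2
    have h4 : 0 ≤ (1 - (t : ℝ)) * |x.1.2| := mul_nonneg (by linarith) (abs_nonneg _)
    have ht : (t : ℝ) = 0 := by linarith
    simp only [ht, sub_zero, one_smul, one_mul, add_zero, abs_eq_zero] at h1 h3
    have : x.1 = 0 := Prod.ext h1 h3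
    have hx := x.2
    simp [this] at hx
  refine ⟨⟨(0, σ), by simp [Prod.norm_def, hσ]⟩, ⟨⟨toSphere F hF, ?_, ?_⟩⟩⟩
  · intro x
    have hx : F (0, x) = (foldSphere σ hσ x).1 := by simp [F, foldSphere]
    ext1
    change ‖F (0, x)‖⁻¹ • F (0, x) = _
    rw [hx, mem_sphere_zero_iff_norm.1 (foldSphere σ hσ x).2, inv_one, one_smul]
  · intro x
    ext1
    simp [toSphere, F, Prod.norm_def, hσ]

/-- A perturbation-invariant property of maps on a sphere that holds for constant maps holds for
maps that factor through a hemisphere. -/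
theorem induction_foldSphere [ProperSpace V] {B : Type*} [TopologicalSpace B]
    (P : C(Metric.sphere (0 : V × ℝ) 1, B) → Prop) (U : Set (B × B)) (hU : ∀ b, U ∈ 𝓝 (b, b))
    (hP : ∀ b b' : C(Metric.sphere (0 : V × ℝ) 1, B), (∀ x, (b x, b' x) ∈ U) → P b → P b')
    (hc : ∀ y, P (.const _ y)) (σ : ℝ) (hσ : |σ| = 1) (b : C(Metric.sphere (0 : V × ℝ) 1, B)) :
    P (b.comp (foldSphere σ hσ)) := by
  obtain ⟨y, hy⟩ := foldSphere_homotopic_const (V := V) σ hσ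
  have h := (ContinuousMap.Homotopic.refl b).comp hy
  exact h.symm.induction_of_close P U hU hP (hc (b y))

end Sphere

/-- Every nowhere vanishing complex function on a two-dimensional sphere has a logarithm. -/
theorem exists_exp_eq (c : C(Metric.sphere (0 : ℂ × ℝ) 1, {z : ℂ // z ≠ 0})) :
    ∃ w : C(Metric.sphere (0 : ℂ × ℝ) 1, ℂ), ∀ x, Complex.exp (w x) = c x := by
  let P : C(Metric.sphere (0 : ℂ × ℝ) 1, {z : ℂ // z ≠ 0}) → Prop := fun b =>
    ∃ w : C(Metric.sphere (0 : ℂ × ℝ) 1, ℂ), ∀ x, Complex.exp (w x) = b x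
  let U : Set ({z : ℂ // z ≠ 0} × {z : ℂ // z ≠ 0}) := {p | p.2.1 / p.1.1 ∈ Complex.slitPlane}
  have hU : ∀ b, U ∈ 𝓝 (b, b) := by
    intro b
    refine IsOpen.mem_nhds ?_ (by simp [U, b.2])
    refine Complex.isOpen_slitPlane.preimage (f := fun p : {z : ℂ // z ≠ 0} × {z : ℂ // z ≠ 0} =>
      p.2.1 / p.1.1) ?_
    exact Continuous.div (by fun_prop) (by fun_prop) fun p => p.1.2
  have hP : ∀ b b', (∀ x, (b x, b' x) ∈ U) → P b → P b' := by
    rintro b b' h ⟨w, hw⟩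
    refine ⟨⟨fun x => w x + Complex.log (b' x / b x), ?_⟩, fun x => ?_⟩
    · refine w.continuous.add (Continuous.clog ?_ h)
      exact Continuous.div (by fun_prop) (by fun_prop) fun x => (b x).2
    · have h1 := (b x).2
      have h2 := (b' x).2
      change Complex.exp (w x + Complex.log (b' x / b x)) = _
      rw [Complex.exp_add, Complex.exp_log (div_ne_zero h2 h1), hw]
      field_simp
  have hc : ∀ y, P (.const _ y) := fun y =>
    ⟨.const _ (Complex.log y), fun _ => Complex.exp_log y.2⟩
  obtain ⟨p, hp⟩ := induction_foldSphere P U hU hP hc 1 (by simp) c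
  obtain ⟨m, hm⟩ := induction_foldSphere P U hU hP hc (-1) (by simp) c
  have hp' : ∀ x : Metric.sphere (0 : ℂ × ℝ) 1, 0 ≤ x.1.2 → Complex.exp (p x) = c x := by
    intro x hx
    rw [hp, ContinuousMap.comp_apply, foldSphere_one_of_nonneg hx]
  have hm' : ∀ x : Metric.sphere (0 : ℂ × ℝ) 1, x.1.2 ≤ 0 → Complex.exp (m x) = c x := by
    intro x hx
    rw [hm, ContinuousMap.comp_apply, foldSphere_neg_one_of_nonpos hx]
  let y₀ : Metric.sphere (0 : ℂ) 1 := ⟨1, by simp⟩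
  let d := p (equator y₀) - m (equator y₀)
  have hpm : ∀ y, Complex.exp (p (equator y)) = Complex.exp (m (equator y)) := fun y =>
    (hp' _ le_rfl).trans (hm' _ le_rfl).symm
  have hd : Complex.exp d = 1 := by
    rw [Complex.exp_sub, hpm, div_self (Complex.exp_ne_zero _)]
  have : PreconnectedSpace (Metric.sphere (0 : ℂ) 1) :=
    Subtype.preconnectedSpace (isPreconnected_sphere (by simp) 0 1)
  have heq : (fun y => p (equator y)) = fun y => m (equator y) + d := by
    refine Complex.isCoveringMap_exp.eq_of_comp_eq (by fun_prop) (by fun_prop) ?_ y₀ (by simp [d])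
    funext y
    simp [Complex.exp_add, hd, hpm]
  obtain ⟨e, hep, hem⟩ := exists_glue_hemispheres p (m + .const _ d) fun y => congrFun heq y
  refine ⟨e, fun x => ?_⟩
  rcases le_total 0 x.1.2 with hx | hx
  · rw [hep x hx, hp' x hx]
  · rw [hem x hx]
    simp [Complex.exp_add, hd, hm' x hx]

/-- The quaternion unit `i`. -/
def quatI : ℍ[ℝ] := ⟨0, 1, 0, 0⟩

/-- The quaternion unit `j`. -/
def quatJ : ℍ[ℝ] := ⟨0, 0, 1, 0⟩

/-- The quaternion unit `k`. -/
def quatK : ℍ[ℝ] := ⟨0, 0, 0, 1⟩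

@[simp] theorem re_quatI : quatI.re = 0 := rfl
@[simp] theorem imI_quatI : quatI.imI = 1 := rfl
@[simp] theorem imJ_quatI : quatI.imJ = 0 := rfl
@[simp] theorem imK_quatI : quatI.imK = 0 := rfl
@[simp] theorem re_quatJ : quatJ.re = 0 := rfl
@[simp] theorem imI_quatJ : quatJ.imI = 0 := rfl
@[simp] theorem imJ_quatJ : quatJ.imJ = 1 := rfl
@[simp] theorem imK_quatJ : quatJ.imK = 0 := rfl
@[simp] theorem re_quatK : quatK.re = 0 := rfl
@[simp] theorem imI_quatK : quatK.imI = 0 := rfl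
@[simp] theorem imJ_quatK : quatK.imJ = 0 := rfl
@[simp] theorem imK_quatK : quatK.imK = 1 := rfl

theorem quatI_mul_self : quatI * quatI = -1 := by ext <;> simp
theorem quatJ_mul_self : quatJ * quatJ = -1 := by ext <;> simp
theorem quatK_mul_self : quatK * quatK = -1 := by ext <;> simp
theorem quatI_mul_quatJ : quatI * quatJ = quatK := by ext <;> simp
theorem quatJ_mul_quatI : quatJ * quatI = -quatK := by ext <;> simp
theorem quatJ_mul_quatK : quatJ * quatK = quatI := by ext <;> simp
theorem quatK_mul_quatJ : quatK * quatJ = -quatI := by ext <;> simp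
theorem quatK_mul_quatI : quatK * quatI = quatJ := by ext <;> simp
theorem quatI_mul_quatK : quatI * quatK = -quatJ := by ext <;> simp

theorem norm_eq_one_of_mul_self_eq_neg_one {b : ℍ[ℝ]} (hb : b * b = -1) : ‖b‖ = 1 := by
  have h : ‖b‖ * ‖b‖ = 1 := by rw [← norm_mul, hb]; simp
  nlinarith [norm_nonneg b]

theorem norm_quatI : ‖quatI‖ = 1 := norm_eq_one_of_mul_self_eq_neg_one quatI_mul_self
theorem norm_quatJ : ‖quatJ‖ = 1 := norm_eq_one_of_mul_self_eq_neg_one quatJ_mul_self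
theorem norm_quatK : ‖quatK‖ = 1 := norm_eq_one_of_mul_self_eq_neg_one quatK_mul_self

theorem sub_mul_quatI_intertwines {b : ℍ[ℝ]} (hb : b * b = -1) (q : ℍ[ℝ]) :
    b * (q - b * q * quatI) = (q - b * q * quatI) * quatI := by
  have h1 : b * (q - b * q * quatI) = b * q - b * b * q * quatI := by noncomm_ring
  have h2 : (q - b * q * quatI) * quatI = q * quatI - b * q * (quatI * quatI) := by noncomm_ring
  rw [h1, h2, hb, quatI_mul_self]
  noncomm_ring

theorem exists_mul_eq_mul_quatI {b : ℍ[ℝ]} (hb : b * b = -1) :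
    ∃ q : ℍ[ℝ], q ≠ 0 ∧ b * q = q * quatI := by
  by_cases h : b * quatI = 1
  · have hb' : b = -quatI := by
      have : b * (quatI * quatI) = quatI := by rw [← mul_assoc, h, one_mul]
      rw [quatI_mul_self] at this
      rw [← this]
      simp
    refine ⟨quatJ, norm_ne_zero_iff.1 (by simp [norm_quatJ]), ?_⟩
    rw [hb', neg_mul, quatI_mul_quatJ, quatJ_mul_quatI]
  · refine ⟨1 - b * 1 * quatI, ?_, sub_mul_quatI_intertwines hb 1⟩
    rw [mul_one, sub_ne_zero]
    exact Ne.symm h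

/-- A quaternion commuting with `i` is a complex number. -/
theorem eq_coeComplex_of_commute_quatI {z : ℍ[ℝ]} (h : quatI * z = z * quatI) :
    z = ((⟨z.re, z.imI⟩ : ℂ) : ℍ[ℝ]) := by
  have h1 := congrArg QuaternionAlgebra.imJ h
  have h2 := congrArg QuaternionAlgebra.imK h
  simp at h1 h2
  ext <;> simp <;> linarith

theorem coeComplex_mul_quatI (z : ℂ) : (z : ℍ[ℝ]) * quatI = quatI * z := by
  ext <;> simp

/-- A map from the three-sphere to the two-sphere of imaginary unit quaternions lifts through the
Hopf fibration `q ↦ q i q⁻¹`. -/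
theorem exists_hopf_lift (b : C(Metric.sphere (0 : (ℂ × ℝ) × ℝ) 1, {b : ℍ[ℝ] // b * b = -1})) :
    ∃ q : C(Metric.sphere (0 : (ℂ × ℝ) × ℝ) 1, ℍ[ℝ]),
      ∀ x, q x ≠ 0 ∧ (b x : ℍ[ℝ]) * q x = q x * quatI := by
  let P : C(Metric.sphere (0 : (ℂ × ℝ) × ℝ) 1, {b : ℍ[ℝ] // b * b = -1}) → Prop := fun b =>
    ∃ q : C(Metric.sphere (0 : (ℂ × ℝ) × ℝ) 1, ℍ[ℝ]),
      ∀ x, q x ≠ 0 ∧ (b x : ℍ[ℝ]) * q x = q x * quatI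
  let U : Set ({b : ℍ[ℝ] // b * b = -1} × {b : ℍ[ℝ] // b * b = -1}) :=
    {p | ‖p.2.1 - p.1.1‖ < 1}
  have hU : ∀ b, U ∈ 𝓝 (b, b) := fun b =>
    (isOpen_lt (by fun_prop) (by fun_prop)).mem_nhds (by simp)
  have hP : ∀ b b', (∀ x, (b x, b' x) ∈ U) → P b → P b' := by
    rintro b b' h ⟨q, hq⟩
    refine ⟨⟨fun x => q x - b' x * q x * quatI, by fun_prop⟩, fun x =>
      ⟨fun h0 => ?_, sub_mul_quatI_intertwines (b' x).2 _⟩⟩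
    obtain ⟨hq0, hq1⟩ := hq x
    have h1 : ((b' x : ℍ[ℝ]) - b x) * q x * quatI = q x + q x := by
      have h2 : (b x : ℍ[ℝ]) * q x * quatI = -q x := by
        rw [hq1, mul_assoc, quatI_mul_self, mul_neg_one]
      have h3 : (b' x : ℍ[ℝ]) * q x * quatI = q x := (sub_eq_zero.1 h0).symm
      rw [sub_mul, sub_mul, h2, h3, sub_neg_eq_add]
    have h4 : ‖((b' x : ℍ[ℝ]) - b x)‖ < 1 := h x
    have h5 := congrArg norm h1
    rw [norm_mul, norm_mul, norm_quatI, ← two_smul ℝ, norm_smul, Real.norm_two, mul_one] at h5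
    nlinarith [norm_pos_iff.2 hq0]
  have hc : ∀ y, P (.const _ y) := fun y => by
    obtain ⟨q, hq⟩ := exists_mul_eq_mul_quatI y.2
    exact ⟨.const _ q, fun _ => hq⟩
  obtain ⟨p, hp⟩ := induction_foldSphere P U hU hP hc 1 (by simp) b
  obtain ⟨m, hm⟩ := induction_foldSphere P U hU hP hc (-1) (by simp) b
  have hp0 : ∀ x, p x ≠ 0 := fun x => (hp x).1
  have hm0 : ∀ x, m x ≠ 0 := fun x => (hm x).1
  have hp' : ∀ x : Metric.sphere (0 : (ℂ × ℝ) × ℝ) 1, 0 ≤ x.1.2 →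
      (b x : ℍ[ℝ]) * p x = p x * quatI := by
    intro x hx
    rw [← (hp x).2, ContinuousMap.comp_apply, foldSphere_one_of_nonneg hx]
  have hm' : ∀ x : Metric.sphere (0 : (ℂ × ℝ) × ℝ) 1, x.1.2 ≤ 0 →
      (b x : ℍ[ℝ]) * m x = m x * quatI := by
    intro x hx
    rw [← (hm x).2, ContinuousMap.comp_apply, foldSphere_neg_one_of_nonpos hx]
  let z : C(Metric.sphere (0 : ℂ × ℝ) 1, ℍ[ℝ]) :=
    ⟨fun y => (p (equator y))⁻¹ * m (equator y),
      (Continuous.inv₀ (by fun_prop) fun y => hp0 _).mul (by fun_prop)⟩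
  have hz0 : ∀ y, z y ≠ 0 := fun y => mul_ne_zero (inv_ne_zero (hp0 _)) (hm0 _)
  have hpz : ∀ y, p (equator y) * z y = m (equator y) := fun y =>
    mul_inv_cancel_left₀ (hp0 _) _
  have hz : ∀ y, z y = ((⟨(z y).re, (z y).imI⟩ : ℂ) : ℍ[ℝ]) := by
    intro y
    refine eq_coeComplex_of_commute_quatI ?_
    refine mul_left_cancel₀ (hp0 (equator y)) ?_
    rw [← mul_assoc, ← mul_assoc, hpz, ← hp' _ le_rfl, mul_assoc, hpz, hm' _ le_rfl]
  obtain ⟨w, hw⟩ := exists_exp_eq ⟨fun y => ⟨⟨(z y).re, (z y).imI⟩, fun h => hz0 y <| by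
    rw [hz y, h, Quaternion.coeComplex_zero]⟩, by
      refine Continuous.subtype_mk ?_ _
      have h1 : Continuous fun y => (z y).re := Quaternion.continuous_re.comp z.continuous
      have h2 : Continuous fun y => (z y).imI := Quaternion.continuous_imI.comp z.continuous
      exact Complex.equivRealProdCLM.symm.continuous.comp (h1.prodMk h2)⟩
  let W : ℂ × ℝ → ℂ := fun v => coneExt (fun p : Unit × _ => w p.2) ((), v)
  have hW : Continuous W :=
    (continuous_coneExt _ (by fun_prop)).comp (by fun_prop)
  have hcoe : Continuous fun z : ℂ => (z : ℍ[ℝ]) :=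
    Quaternion.ofComplex.toLinearMap.continuous_of_finiteDimensional
  obtain ⟨e, hep, hem⟩ := exists_glue_hemispheres
    ⟨fun x => p x * ((Complex.exp (W x.1.1) : ℂ) : ℍ[ℝ]),
      p.continuous.mul (hcoe.comp (by fun_prop))⟩ m fun y => by
      change p (equator y) * ((Complex.exp (W y) : ℂ) : ℍ[ℝ]) = m (equator y)
      have : W y = w y := coneExt_coe (fun p : Unit × _ => w p.2) () y
      rw [this, hw, ← hpz]
      exact congrArg _ (hz y).symm
  refine ⟨e, fun x => ?_⟩
  rcases le_total 0 x.1.2 with hx | hx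
  · rw [hep x hx]
    refine ⟨mul_ne_zero (hp0 x) fun h => Complex.exp_ne_zero (W x.1.1) ?_, ?_⟩
    · have h1 := congrArg QuaternionAlgebra.re h
      have h2 := congrArg QuaternionAlgebra.imI h
      exact Complex.ext (by simpa using h1) (by simpa using h2)
    · change (b x : ℍ[ℝ]) * (p x * _) = p x * _ * quatI
      rw [mul_assoc, coeComplex_mul_quatI, ← mul_assoc, hp' x hx, mul_assoc]
  · rw [hem x hx]
    exact ⟨hm0 x, hm' x hx⟩

/-- A column of a `3 × 3` matrix as an imaginary quaternion. -/
def quatCol (A : Matrix (Fin 3) (Fin 3) ℝ) (j : Fin 3) : ℍ[ℝ] := ⟨0, A 0 j, A 1 j, A 2 j⟩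

@[simp] theorem re_quatCol (A : Matrix (Fin 3) (Fin 3) ℝ) (j : Fin 3) :
    (quatCol A j).re = 0 := rfl
@[simp] theorem imI_quatCol (A : Matrix (Fin 3) (Fin 3) ℝ) (j : Fin 3) :
    (quatCol A j).imI = A 0 j := rfl
@[simp] theorem imJ_quatCol (A : Matrix (Fin 3) (Fin 3) ℝ) (j : Fin 3) :
    (quatCol A j).imJ = A 1 j := rfl
@[simp] theorem imK_quatCol (A : Matrix (Fin 3) (Fin 3) ℝ) (j : Fin 3) :
    (quatCol A j).imK = A 2 j := rfl

theorem continuous_quatCol (j : Fin 3) : Continuous fun A => quatCol A j := by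
  have h : ∀ A, quatCol A j = A 0 j • quatI + A 1 j • quatJ + A 2 j • quatK := by
    intro A
    ext <;> simp
  simp only [h]
  fun_prop

theorem continuous_quatCol_val (j : Fin 3) : Continuous fun A : SO 3 => quatCol A.1 j :=
  (continuous_quatCol j).comp continuous_subtype_val

section

variable (A : SO 3)

theorem SO3_dot (i j : Fin 3) :
    A.1 0 i * A.1 0 j + A.1 1 i * A.1 1 j + A.1 2 i * A.1 2 j = if i = j then 1 else 0 := by
  have h := congrFun (congrFun A.2.1 i) j
  simpa [Matrix.mul_apply, Fin.sum_univ_three, Matrix.one_apply] using h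

theorem SO3_adjugate : A.1.adjugate = A.1ᵀ := by
  have h := Matrix.mul_adjugate A.1
  rw [A.2.2, one_smul] at h
  calc A.1.adjugate = A.1ᵀ * A.1 * A.1.adjugate := by rw [A.2.1, one_mul]
    _ = A.1ᵀ := by rw [mul_assoc, h, mul_one]

theorem quatCol_mul_self (j : Fin 3) : quatCol A.1 j * quatCol A.1 j = -1 := by
  have h := SO3_dot A j j
  simp only [if_true] at h
  ext <;> simp <;> linarith

theorem quatCol_zero_mul_one : quatCol A.1 0 * quatCol A.1 1 = quatCol A.1 2 := by
  have h := SO3_dot A 0 1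
  have h' := SO3_adjugate A
  rw [Matrix.adjugate_fin_three] at h'
  have h0 := congrFun (congrFun h' 2) 0
  have h1 := congrFun (congrFun h' 2) 1
  have h2 := congrFun (congrFun h' 2) 2
  simp at h h0 h1 h2
  ext <;> simp <;> linarith

end

/-- `q` conjugates the standard imaginary units to the columns of `A`. -/
def QuatLifts (q : ℍ[ℝ]) (A : Matrix (Fin 3) (Fin 3) ℝ) : Prop :=
  q ≠ 0 ∧ quatCol A 0 * q = q * quatI ∧ quatCol A 1 * q = q * quatJ ∧ quatCol A 2 * q = q * quatK

/-- The averaging operator `q ↦ ∑ A(e) q e⁻¹` over the four units `e = 1, i, j, k`. -/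
noncomputable def quatAvg (A : Matrix (Fin 3) (Fin 3) ℝ) (q : ℍ[ℝ]) : ℍ[ℝ] :=
  q - quatCol A 0 * q * quatI - quatCol A 1 * q * quatJ - quatCol A 2 * q * quatK

theorem quatLifts_quatAvg (A : SO 3) (q : ℍ[ℝ]) (h : quatAvg A.1 q ≠ 0) :
    QuatLifts (quatAvg A.1 q) A.1 := by
  have aa := quatCol_mul_self A 0
  have bb := quatCol_mul_self A 1
  have cc := quatCol_mul_self A 2
  have ab := quatCol_zero_mul_one A
  unfold QuatLifts
  refine ⟨h, ?_⟩
  unfold quatAvg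
  generalize quatCol A.1 0 = a at *
  generalize quatCol A.1 1 = b at *
  generalize quatCol A.1 2 = c at *
  have ac : a * c = -b := by rw [← ab, ← mul_assoc, aa, neg_one_mul]
  have cb : c * b = -a := by rw [← ab, mul_assoc, bb, mul_neg_one]
  have ba : b * a = -c := by
    have : b * (a * c) = 1 := by rw [ac, mul_neg, bb, neg_neg]
    calc b * a = -(b * (a * (c * c))) := by rw [cc]; simp
      _ = -(b * (a * c) * c) := by noncomm_ring
      _ = -c := by rw [this, one_mul]
  have bc : b * c = a := by
    have : -(b * a) = c := by rw [ba, neg_neg]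
    rw [← this, mul_neg, ← mul_assoc, bb]
    simp
  have ca : c * a = b := by
    rw [← ab, mul_assoc, ba, mul_neg, ac, neg_neg]
  have expand : ∀ x : ℍ[ℝ], x * (q - a * q * quatI - b * q * quatJ - c * q * quatK) =
      x * q - (x * a) * q * quatI - (x * b) * q * quatJ - (x * c) * q * quatK := by
    intro x
    noncomm_ring
  have expand' : ∀ x : ℍ[ℝ], (q - a * q * quatI - b * q * quatJ - c * q * quatK) * x =
      q * x - a * q * (quatI * x) - b * q * (quatJ * x) - c * q * (quatK * x) := by
    intro x
    noncomm_ring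
  simp only [expand, expand', aa, bb, cc, ab, ac, cb, ba, bc, ca, quatI_mul_self, quatJ_mul_self,
    quatK_mul_self, quatI_mul_quatJ, quatJ_mul_quatI, quatJ_mul_quatK, quatK_mul_quatJ,
    quatK_mul_quatI, quatI_mul_quatK]
  refine ⟨?_, ?_, ?_⟩ <;> noncomm_ring

theorem exists_quatLifts (A : SO 3) : ∃ q, QuatLifts q A.1 := by
  by_contra! hne
  have h0 : ∀ q, quatAvg A.1 q = 0 := by
    intro q
    by_contra h
    exact hne _ (quatLifts_quatAvg A q h)
  have h1 := congrArg QuaternionAlgebra.re (h0 1)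
  have h2 := congrArg QuaternionAlgebra.imI (h0 quatI)
  have h3 := congrArg QuaternionAlgebra.imJ (h0 quatJ)
  have h4 := congrArg QuaternionAlgebra.imK (h0 quatK)
  simp [quatAvg] at h1 h2 h3 h4
  linarith

theorem quatAvg_ne_zero {q : ℍ[ℝ]} {A A' : Matrix (Fin 3) (Fin 3) ℝ} (h : QuatLifts q A)
    (hA : ∀ j, ‖quatCol A' j - quatCol A j‖ < 1) : quatAvg A' q ≠ 0 := by
  intro h0
  obtain ⟨hq, h1, h2, h3⟩ := h
  have e : (4 : ℝ) • q = (quatCol A' 0 - quatCol A 0) * q * quatI +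
      (quatCol A' 1 - quatCol A 1) * q * quatJ + (quatCol A' 2 - quatCol A 2) * q * quatK := by
    have e1 : quatCol A 0 * q * quatI = -q := by rw [h1, mul_assoc, quatI_mul_self, mul_neg_one]
    have e2 : quatCol A 1 * q * quatJ = -q := by rw [h2, mul_assoc, quatJ_mul_self, mul_neg_one]
    have e3 : quatCol A 2 * q * quatK = -q := by rw [h3, mul_assoc, quatK_mul_self, mul_neg_one]
    simp only [sub_mul, e1, e2, e3]
    have e4 : q = quatCol A' 0 * q * quatI + quatCol A' 1 * q * quatJ +
        quatCol A' 2 * q * quatK := by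
      rw [← sub_eq_zero, ← h0, quatAvg]
      abel
    have e5 : (4 : ℝ) • q = q + 3 • q := by module
    rw [e5]
    nth_rewrite 1 [e4]
    module
  have hn := congrArg norm e
  have hq' := norm_pos_iff.2 hq
  have key : ∀ j (x : ℍ[ℝ]), ‖x‖ = 1 → ‖(quatCol A' j - quatCol A j) * q * x‖ < ‖q‖ := by
    intro j x hx
    rw [norm_mul, norm_mul, hx, mul_one]
    exact mul_lt_of_lt_one_left hq' (hA j)
  have k0 := key 0 _ norm_quatI
  have k1 := key 1 _ norm_quatJ
  have k2 := key 2 _ norm_quatK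
  have t1 := norm_add₃_le (a := (quatCol A' 0 - quatCol A 0) * q * quatI)
    (b := (quatCol A' 1 - quatCol A 1) * q * quatJ) (c := (quatCol A' 2 - quatCol A 2) * q * quatK)
  rw [norm_smul, Real.norm_of_nonneg (by norm_num : (0 : ℝ) ≤ 4)] at hn
  linarith

theorem QuatLifts.smul {q : ℍ[ℝ]} {A : Matrix (Fin 3) (Fin 3) ℝ} (h : QuatLifts q A) {r : ℝ}
    (hr : r ≠ 0) : QuatLifts (r • q) A := by
  obtain ⟨hq, h1, h2, h3⟩ := h
  exact ⟨smul_ne_zero hr hq, by simp [h1], by simp [h2], by simp [h3]⟩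

/-- Two quaternions inducing the same rotation are proportional. -/
theorem QuatLifts.exists_smul_eq {p q : ℍ[ℝ]} {A : Matrix (Fin 3) (Fin 3) ℝ} (hp : QuatLifts p A)
    (hq : QuatLifts q A) : q = (p⁻¹ * q).re • p := by
  obtain ⟨hp0, p1, p2, -⟩ := hp
  obtain ⟨-, q1, q2, -⟩ := hq
  have hpz : p * (p⁻¹ * q) = q := mul_inv_cancel_left₀ hp0 q
  generalize p⁻¹ * q = z at hpz ⊢
  have c1 : quatI * z = z * quatI := by
    refine mul_left_cancel₀ hp0 ?_
    rw [← mul_assoc, ← mul_assoc, hpz, ← p1, mul_assoc, hpz, q1]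
  have c2 : quatJ * z = z * quatJ := by
    refine mul_left_cancel₀ hp0 ?_
    rw [← mul_assoc, ← mul_assoc, hpz, ← p2, mul_assoc, hpz, q2]
  have hr : z = (z.re : ℍ[ℝ]) := by
    have d1 := congrArg QuaternionAlgebra.imJ c1
    have d2 := congrArg QuaternionAlgebra.imK c1
    have d3 := congrArg QuaternionAlgebra.imK c2
    simp at d1 d2 d3
    ext <;> simp <;> linarith
  rw [← hpz]
  nth_rewrite 1 [hr]
  exact Quaternion.mul_coe_eq_smul _ _

/-- A map from a sphere of dimension at least two to `SO(3)` lifts to the unit quaternions. -/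
theorem exists_unit_quaternion_lift {V : Type*} [NormedAddCommGroup V] [NormedSpace ℝ V]
    [ProperSpace V] (hV : 1 < Module.rank ℝ V) (f : C(Metric.sphere (0 : V × ℝ) 1, SO 3)) :
    ∃ q : C(Metric.sphere (0 : V × ℝ) 1, ℍ[ℝ]), ∀ x, ‖q x‖ = 1 ∧ QuatLifts (q x) (f x).1 := by
  let P : C(Metric.sphere (0 : V × ℝ) 1, SO 3) → Prop := fun b =>
    ∃ q : C(Metric.sphere (0 : V × ℝ) 1, ℍ[ℝ]), ∀ x, ‖q x‖ = 1 ∧ QuatLifts (q x) (b x).1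
  let U : Set (SO 3 × SO 3) := {p | ∀ j, ‖quatCol p.2.1 j - quatCol p.1.1 j‖ < 1}
  have hU : ∀ b, U ∈ 𝓝 (b, b) := by
    intro b
    refine IsOpen.mem_nhds ?_ (by simp [U])
    simp only [U, Set.ofPred_forall]
    refine isOpen_iInter_of_finite fun j => isOpen_lt ?_ continuous_const
    exact (((continuous_quatCol_val j).comp continuous_snd).sub
      ((continuous_quatCol_val j).comp continuous_fst)).norm
  have hP : ∀ b b', (∀ x, (b x, b' x) ∈ U) → P b → P b' := by
    rintro b b' h ⟨q, hq⟩
    have hne : ∀ x, quatAvg (b' x).1 (q x) ≠ 0 := fun x => quatAvg_ne_zero (hq x).2 (h x)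
    have hcont : Continuous fun x => quatAvg (b' x).1 (q x) := by
      have hcol : ∀ j, Continuous fun x => quatCol (b' x).1 j := fun j =>
        (continuous_quatCol_val j).comp b'.continuous
      have := hcol 0
      have := hcol 1
      have := hcol 2
      unfold quatAvg
      fun_prop
    have hn0 : ∀ x, ‖quatAvg (b' x).1 (q x)‖ ≠ 0 := fun x => norm_ne_zero_iff.2 (hne x)
    refine ⟨⟨fun x => ‖quatAvg (b' x).1 (q x)‖⁻¹ • quatAvg (b' x).1 (q x),
      (hcont.norm.inv₀ hn0).smul hcont⟩, fun x => ⟨?_, ?_⟩⟩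
    · exact mem_sphere_zero_iff_norm.1 (inv_norm_smul_mem_sphere (hne x))
    · exact (quatLifts_quatAvg _ _ (hne x)).smul (inv_ne_zero (hn0 x))
  have hc : ∀ y, P (.const _ y) := fun y => by
    obtain ⟨q, hq⟩ := exists_quatLifts y
    exact ⟨.const _ (‖q‖⁻¹ • q), fun _ =>
      ⟨mem_sphere_zero_iff_norm.1 (inv_norm_smul_mem_sphere hq.1),
        hq.smul (inv_ne_zero (norm_ne_zero_iff.2 hq.1))⟩⟩
  obtain ⟨p, hp⟩ := induction_foldSphere P U hU hP hc 1 (by simp) f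
  obtain ⟨m, hm⟩ := induction_foldSphere P U hU hP hc (-1) (by simp) f
  have hp' : ∀ x : Metric.sphere (0 : V × ℝ) 1, 0 ≤ x.1.2 → QuatLifts (p x) (f x).1 := by
    intro x hx
    have := (hp x).2
    rwa [ContinuousMap.comp_apply, foldSphere_one_of_nonneg hx] at this
  have hm' : ∀ x : Metric.sphere (0 : V × ℝ) 1, x.1.2 ≤ 0 → QuatLifts (m x) (f x).1 := by
    intro x hx
    have := (hm x).2
    rwa [ContinuousMap.comp_apply, foldSphere_neg_one_of_nonpos hx] at this
  let r : Metric.sphere (0 : V) 1 → ℝ := fun y => ((p (equator y))⁻¹ * m (equator y)).re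
  have hr : Continuous r := Quaternion.continuous_re.comp
    ((Continuous.inv₀ (by fun_prop) fun y => (hp _).2.1).mul (by fun_prop))
  have hpr : ∀ y, m (equator y) = r y • p (equator y) := fun y =>
    (hp' _ le_rfl).exists_smul_eq (hm' _ le_rfl)
  have hr1 : ∀ y, |r y| = 1 := by
    intro y
    have := congrArg norm (hpr y)
    rw [norm_smul, (hp _).1, (hm _).1, mul_one] at this
    exact this.symm
  have : PreconnectedSpace (Metric.sphere (0 : V) 1) :=
    Subtype.preconnectedSpace (isPreconnected_sphere hV 0 1)
  obtain ⟨σ, hσ, hrσ⟩ : ∃ σ : ℝ, |σ| = 1 ∧ ∀ y, r y = σ := by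
    by_cases h : ∃ y, r y = 1
    · obtain ⟨y, hy⟩ := h
      refine ⟨1, by simp, fun y' => ?_⟩
      by_contra hy'
      have hy'' : r y' = -1 := (eq_or_eq_neg_of_abs_eq (hr1 y')).resolve_left hy'
      obtain ⟨z, hz⟩ := mem_range_of_exists_le_of_exists_ge hr
        ⟨y', (by rw [hy'']; norm_num : r y' ≤ 0)⟩ ⟨y, (by rw [hy]; norm_num : 0 ≤ r y)⟩
      have := hr1 z
      simp [hz] at this
    · push Not at h
      exact ⟨-1, by simp, fun y => (eq_or_eq_neg_of_abs_eq (hr1 y)).resolve_left (h y)⟩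
  obtain ⟨e, hep, hem⟩ := exists_glue_hemispheres (σ • p) m fun y => by
    rw [hpr, hrσ]
    rfl
  have hσ0 : σ ≠ 0 := by rintro rfl; simp at hσ
  refine ⟨e, fun x => ?_⟩
  rcases le_total 0 x.1.2 with hx | hx
  · rw [hep x hx]
    refine ⟨?_, (hp' x hx).smul hσ0⟩
    simp [norm_smul, hσ, (hp x).1]
  · rw [hem x hx]
    exact ⟨(hm x).1, hm' x hx⟩

/-- Homotopy through nowhere vanishing maps. -/
def NonvanishingHomotopic {X E : Type*} [TopologicalSpace X] [TopologicalSpace E] [Zero E]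
    (f g : X → E) : Prop :=
  ∃ f' g' : C(X, {e : E // e ≠ 0}), (∀ x, (f' x : E) = f x) ∧ (∀ x, (g' x : E) = g x) ∧
    f'.Homotopic g'

namespace NonvanishingHomotopic

variable {X E : Type*} [TopologicalSpace X] [TopologicalSpace E] [Zero E] {f g h : X → E}

theorem symm (H : NonvanishingHomotopic f g) : NonvanishingHomotopic g f := by
  obtain ⟨f', g', hf, hg, H⟩ := H
  exact ⟨g', f', hg, hf, H.symm⟩

theorem trans (H : NonvanishingHomotopic f g) (K : NonvanishingHomotopic g h) :
    NonvanishingHomotopic f h := by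
  obtain ⟨f', g', hf, hg, H⟩ := H
  obtain ⟨g'', h', hg', hh, K⟩ := K
  have : g' = g'' := by
    ext x
    rw [hg, hg']
  subst this
  exact ⟨f', h', hf, hh, H.trans K⟩

theorem of_continuous {H : unitInterval → X → E}
    (hc : Continuous fun p : unitInterval × X => H p.1 p.2)
    (h0 : ∀ t x, H t x ≠ 0) : NonvanishingHomotopic (H 0) (H 1) :=
  ⟨⟨fun x => ⟨H 0 x, h0 0 x⟩, (hc.comp (Continuous.prodMk_right 0)).subtype_mk _⟩,
    ⟨fun x => ⟨H 1 x, h0 1 x⟩, (hc.comp (Continuous.prodMk_right 1)).subtype_mk _⟩,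
    fun _ => rfl, fun _ => rfl,
    ⟨⟨⟨fun p => ⟨H p.1 p.2, h0 p.1 p.2⟩, hc.subtype_mk _⟩, fun _ => rfl, fun _ => rfl⟩⟩⟩

theorem precomp {Y : Type*} [TopologicalSpace Y] (H : NonvanishingHomotopic f g) (k : C(Y, X)) :
    NonvanishingHomotopic (f ∘ k) (g ∘ k) := by
  obtain ⟨f', g', hf, hg, H⟩ := H
  exact ⟨f'.comp k, g'.comp k, fun x => hf _, fun x => hg _, H.comp (.refl k)⟩

theorem postcomp {E' : Type*} [TopologicalSpace E'] [Zero E'] (H : NonvanishingHomotopic f g)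
    (k : E → E') (hk : Continuous k) (h0 : ∀ e ≠ 0, k e ≠ 0) :
    NonvanishingHomotopic (k ∘ f) (k ∘ g) := by
  obtain ⟨f', g', hf, hg, H⟩ := H
  let k' : C({e : E // e ≠ 0}, {e : E' // e ≠ 0}) :=
    ⟨fun e => ⟨k e, h0 e e.2⟩, by fun_prop⟩
  exact ⟨k'.comp f', k'.comp g', fun x => congrArg k (hf x), fun x => congrArg k (hg x),
    (ContinuousMap.Homotopic.refl k').comp H⟩

end NonvanishingHomotopic

/-- The set of functions on the unit sphere that are, at each point, given by one out of finitely
many linear functionals. -/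
def sphereLattice (V : Type*) [NormedAddCommGroup V] [NormedSpace ℝ V] :
    Set C(Metric.sphere (0 : V) 1, ℝ) :=
  {g | ∃ T : Finset (V →ₗ[ℝ] ℝ), ∀ x, ∃ l ∈ T, g x = l x}

section

variable {V : Type*} [NormedAddCommGroup V] [NormedSpace ℝ V]

theorem ContinuousLinearMap.mem_sphereLattice (l : V →L[ℝ] ℝ) :
    (⟨fun x => l x, by fun_prop⟩ : C(Metric.sphere (0 : V) 1, ℝ)) ∈ sphereLattice V :=
  ⟨{(l : V →ₗ[ℝ] ℝ)}, fun x => ⟨l, by simp, rfl⟩⟩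

theorem sup_mem_sphereLattice {f g : C(Metric.sphere (0 : V) 1, ℝ)} (hf : f ∈ sphereLattice V)
    (hg : g ∈ sphereLattice V) : f ⊔ g ∈ sphereLattice V := by
  classical
  obtain ⟨S, hS⟩ := hf
  obtain ⟨T, hT⟩ := hg
  refine ⟨S ∪ T, fun x => ?_⟩
  rcases le_total (f x) (g x) with h | h
  · obtain ⟨l, hl, e⟩ := hT x
    exact ⟨l, Finset.mem_union_right _ hl, by rw [ContinuousMap.sup_apply, sup_eq_right.2 h, e]⟩
  · obtain ⟨l, hl, e⟩ := hS x
    exact ⟨l, Finset.mem_union_left _ hl, by rw [ContinuousMap.sup_apply, sup_eq_left.2 h, e]⟩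

theorem inf_mem_sphereLattice {f g : C(Metric.sphere (0 : V) 1, ℝ)} (hf : f ∈ sphereLattice V)
    (hg : g ∈ sphereLattice V) : f ⊓ g ∈ sphereLattice V := by
  classical
  obtain ⟨S, hS⟩ := hf
  obtain ⟨T, hT⟩ := hg
  refine ⟨S ∪ T, fun x => ?_⟩
  rcases le_total (f x) (g x) with h | h
  · obtain ⟨l, hl, e⟩ := hS x
    exact ⟨l, Finset.mem_union_left _ hl, by rw [ContinuousMap.inf_apply, inf_eq_left.2 h, e]⟩
  · obtain ⟨l, hl, e⟩ := hT x
    exact ⟨l, Finset.mem_union_right _ hl, by rw [ContinuousMap.inf_apply, inf_eq_right.2 h, e]⟩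

theorem separatesPointsStrongly_sphereLattice :
    (sphereLattice V).SeparatesPointsStrongly := by
  classical
  intro φ x y
  have hx : ‖(x : V)‖ = 1 := by simp
  have hy : ‖(y : V)‖ = 1 := by simp
  obtain ⟨l₁, h₁⟩ := SeparatingDual.exists_eq_one (R := ℝ)
    (norm_ne_zero_iff.1 (hx.trans_ne one_ne_zero))
  by_cases hxy : (y : V) - l₁ y • (x : V) = 0
  · have hyx := sub_eq_zero.1 hxy
    have hc : |l₁ y| = 1 := by
      rw [hyx, norm_smul, hx, mul_one] at hy
      exact hy
    rcases eq_or_eq_neg_of_abs_eq hc with hc | hc <;> rw [hc] at hyx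
    · have : x = y := Subtype.ext (by simpa using hyx.symm)
      subst this
      exact ⟨_, ContinuousLinearMap.mem_sphereLattice (φ x • l₁), by simp [h₁], by simp [h₁]⟩
    · refine ⟨⟨fun z => φ x * max (l₁ z) 0 + φ y * max (-l₁ z) 0, by fun_prop⟩,
        ⟨{(φ x • l₁ : V →L[ℝ] ℝ).toLinearMap, (-φ y • l₁ : V →L[ℝ] ℝ).toLinearMap}, fun z => ?_⟩,
        by simp [h₁], by simp [hc]⟩
      rcases le_total 0 (l₁ z) with h | h
      · exact ⟨_, Finset.mem_insert_self _ _, by simp [h]⟩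
      · exact ⟨_, Finset.mem_insert_of_mem (Finset.mem_singleton_self _), by simp [h]⟩
  · obtain ⟨l₂, h₂⟩ := SeparatingDual.exists_eq_one (R := ℝ) hxy
    have h₂' : l₂ y = 1 + l₁ y * l₂ x := by
      simpa [sub_eq_iff_eq_add] using h₂
    refine ⟨_, ContinuousLinearMap.mem_sphereLattice
      (φ x • l₁ + (φ y - φ x * l₁ y) • (l₂ - l₂ x • l₁)), ?_, ?_⟩
    · simp [h₁]
    · simp [h₂']
      ring

theorem closure_sphereLattice [ProperSpace V] : closure (sphereLattice V) = ⊤ :=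
  ContinuousMap.sublattice_closure_eq_top _ ⟨_, ContinuousLinearMap.mem_sphereLattice 0⟩
    (fun _ hf _ hg => inf_mem_sphereLattice hf hg) (fun _ hf _ hg => sup_mem_sphereLattice hf hg)
    separatesPointsStrongly_sphereLattice

end

section

variable {V : Type*} [NormedAddCommGroup V] [NormedSpace ℝ V]

/-- Positively homogeneous piecewise linear approximation of quaternion valued functions. -/
theorem exists_piecewise_linear_approx [ProperSpace V] (f : C(Metric.sphere (0 : V) 1, ℍ[ℝ]))
    {ε : ℝ} (hε : 0 < ε) :
    ∃ G : V → ℍ[ℝ], Continuous G ∧ (∀ (c : ℝ) (v : V), 0 ≤ c → G (c • v) = c • G v) ∧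
      (∃ T : Finset (V →ₗ[ℝ] ℍ[ℝ]), ∀ v ≠ 0, ∃ A ∈ T, G v = A v) ∧
      ∀ x : Metric.sphere (0 : V) 1, ‖G x - f x‖ < ε := by
  classical
  have key : ∀ h : C(Metric.sphere (0 : V) 1, ℝ), ∃ g : C(Metric.sphere (0 : V) 1, ℝ),
      (∃ T : Finset (V →ₗ[ℝ] ℝ), ∀ x, ∃ l ∈ T, g x = l x) ∧ ∀ x, |g x - h x| < ε / 4 := by
    intro h
    have hh : h ∈ closure (sphereLattice V) := by
      rw [closure_sphereLattice]
      trivial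
    obtain ⟨g, hg, hd⟩ := Metric.mem_closure_iff.1 hh (ε / 4) (by positivity)
    refine ⟨g, hg, fun x => ?_⟩
    rw [← Real.dist_eq, dist_comm]
    exact (ContinuousMap.dist_apply_le_dist x).trans_lt hd
  obtain ⟨g₀, ⟨T₀, h₀⟩, d₀⟩ := key ⟨fun x => (f x).re, Quaternion.continuous_re.comp f.continuous⟩
  obtain ⟨g₁, ⟨T₁, h₁⟩, d₁⟩ := key ⟨fun x => (f x).imI, Quaternion.continuous_imI.comp f.continuous⟩
  obtain ⟨g₂, ⟨T₂, h₂⟩, d₂⟩ := key ⟨fun x => (f x).imJ, Quaternion.continuous_imJ.comp f.continuous⟩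
  obtain ⟨g₃, ⟨T₃, h₃⟩, d₃⟩ := key ⟨fun x => (f x).imK, Quaternion.continuous_imK.comp f.continuous⟩
  let u : Unit × Metric.sphere (0 : V) 1 → ℍ[ℝ] := fun p =>
    g₀ p.2 • 1 + g₁ p.2 • quatI + g₂ p.2 • quatJ + g₃ p.2 • quatK
  have hu : Continuous u := by fun_prop
  refine ⟨fun v => coneExt u ((), v), (continuous_coneExt u hu).comp (by fun_prop),
    fun c v hc => coneExt_smul u _ hc v,
    ⟨(T₀ ×ˢ T₁ ×ˢ T₂ ×ˢ T₃).image fun p => p.1.smulRight 1 + p.2.1.smulRight quatI +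
      p.2.2.1.smulRight quatJ + p.2.2.2.smulRight quatK, fun v hv => ?_⟩, fun x => ?_⟩
  · let x : Metric.sphere (0 : V) 1 := ⟨‖v‖⁻¹ • v, inv_norm_smul_mem_sphere hv⟩
    obtain ⟨l₀, m₀, e₀⟩ := h₀ x
    obtain ⟨l₁, m₁, e₁⟩ := h₁ x
    obtain ⟨l₂, m₂, e₂⟩ := h₂ x
    obtain ⟨l₃, m₃, e₃⟩ := h₃ x
    refine ⟨_, Finset.mem_image.2 ⟨(l₀, l₁, l₂, l₃), by simp [*], rfl⟩, ?_⟩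
    have hn : ‖v‖ ≠ 0 := norm_ne_zero_iff.2 hv
    have hxv : v = ‖v‖ • (x : V) := by simp [x, smul_smul, hn]
    have : ∀ l : V →ₗ[ℝ] ℝ, l v = ‖v‖ * l x := fun l => by
      conv_lhs => rw [hxv]
      simp
    change coneExt u ((), v) = _
    rw [coneExt_of_ne u hv]
    simp only [LinearMap.add_apply, LinearMap.smulRight_apply, this, ← e₀, ← e₁, ← e₂, ← e₃]
    simp only [u, smul_add, smul_smul, x]
  · change ‖coneExt u ((), (x : V)) - f x‖ < ε
    rw [coneExt_coe]
    have e : u ((), x) - f x = (g₀ x - (f x).re) • 1 + (g₁ x - (f x).imI) • quatI +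
        (g₂ x - (f x).imJ) • quatJ + (g₃ x - (f x).imK) • quatK := by
      ext <;> simp [u]
    have n : ∀ (r : ℝ) (q : ℍ[ℝ]), ‖q‖ = 1 → |r| < ε / 4 → ‖r • q‖ < ε / 4 := by
      intro r q hq hr
      rwa [norm_smul, hq, mul_one]
    rw [e]
    refine (norm_add₄_le).trans_lt ?_
    have := n _ 1 norm_one (d₀ x)
    have := n _ _ norm_quatI (d₁ x)
    have := n _ _ norm_quatJ (d₂ x)
    have := n _ _ norm_quatK (d₃ x)
    simp only [ContinuousMap.coe_mk] at *
    linarith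

/-- A generic ray in the target and a generic line in the source for a finite family of linear
maps onto a space of dimension four from a space of dimension five. -/
theorem exists_generic [FiniteDimensional ℝ V] (hV : Module.finrank ℝ V = 5)
    (T : Finset (V →ₗ[ℝ] ℍ[ℝ])) :
    ∃ p : ℍ[ℝ], p ≠ 0 ∧ ∃ v : V, v ≠ 0 ∧ ∀ A ∈ T, ∀ B ∈ T, ∀ v₁ v₂ : V, ∀ c₁ c₂ : ℝ,
      c₁ ≠ 0 → c₂ ≠ 0 → A v₁ = c₁ • p → B v₂ = c₂ • p → ∀ a b : ℝ, v ≠ a • v₁ + b • v₂ := by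
  classical
  have h1 := Subspace.biUnion_ne_univ_of_top_notMem
    (s := (insert ⊥ (T.image LinearMap.range)).erase (⊤ : Submodule ℝ ℍ[ℝ]))
    (Finset.notMem_erase _ _)
  obtain ⟨p, hp⟩ := (Set.ne_univ_iff_exists_notMem _).1 h1
  simp only [Set.mem_iUnion, not_exists, Finset.mem_erase, Finset.mem_insert,
    Finset.mem_image, SetLike.mem_coe, and_imp] at hp
  have hp0 : p ≠ 0 := fun h => hp ⊥ bot_ne_top (Or.inl rfl) (by simp [h])
  let M : (V →ₗ[ℝ] ℍ[ℝ]) → Submodule ℝ V := fun A => (ℝ ∙ p).comap A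
  have hM : ∀ A ∈ T, LinearMap.range A = ⊤ → Module.finrank ℝ (M A) ≤ 2 := by
    intro A hA hr
    obtain ⟨u, hu⟩ := LinearMap.range_eq_top.1 hr p
    have hle : M A ≤ LinearMap.ker A ⊔ ℝ ∙ u := by
      intro x hx
      obtain ⟨c, hc⟩ := Submodule.mem_span_singleton.1 (Submodule.mem_comap.1 hx)
      rw [← sub_add_cancel x (c • u)]
      exact Submodule.add_mem_sup (by simp [hu, hc])
        (Submodule.smul_mem _ _ (Submodule.mem_span_singleton_self u))
    have h3 := LinearMap.finrank_range_add_finrank_ker A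
    rw [hr, finrank_top, Quaternion.finrank_eq_four] at h3
    have h4 := Submodule.finrank_mono hle
    have h5 := Submodule.finrank_add_le_finrank_add_finrank (LinearMap.ker A) (ℝ ∙ u)
    have h6 := finrank_span_le_card (R := ℝ) ({u} : Set V)
    simp only [Set.toFinset_singleton, Finset.card_singleton] at h6
    omega
  have h2 := Subspace.biUnion_ne_univ_of_top_notMem
    (s := (insert ⊥ ((T ×ˢ T).image fun q => M q.1 ⊔ M q.2)).erase (⊤ : Submodule ℝ V))
    (Finset.notMem_erase _ _)
  obtain ⟨v, hv⟩ := (Set.ne_univ_iff_exists_notMem _).1 h2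
  simp only [Set.mem_iUnion, not_exists, Finset.mem_erase, Finset.mem_insert,
    Finset.mem_image, SetLike.mem_coe, and_imp, Finset.mem_product, Prod.exists] at hv
  have hbt : (⊥ : Submodule ℝ V) ≠ ⊤ := by
    intro h
    have := finrank_top ℝ V
    rw [← h, finrank_bot] at this
    omega
  refine ⟨p, hp0, v, fun h => hv ⊥ hbt (Or.inl rfl) (by simp [h]), ?_⟩
  intro A hA B hB v₁ v₂ c₁ c₂ hc₁ hc₂ e₁ e₂ a b hab
  have hr : ∀ C ∈ T, ∀ w : V, ∀ c : ℝ, c ≠ 0 → C w = c • p → LinearMap.range C = ⊤ := by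
    intro C hC w c hc e
    by_contra hne
    refine hp _ hne (Or.inr ⟨C, hC, rfl⟩) ⟨c⁻¹ • w, ?_⟩
    rw [map_smul, e, smul_smul, inv_mul_cancel₀ hc, one_smul]
  have hA2 := hM A hA (hr A hA v₁ c₁ hc₁ e₁)
  have hB2 := hM B hB (hr B hB v₂ c₂ hc₂ e₂)
  refine hv (M A ⊔ M B) ?_ (Or.inr ⟨A, B, ⟨hA, hB⟩, rfl⟩) ?_
  · intro h
    have := Submodule.finrank_add_le_finrank_add_finrank (M A) (M B)
    rw [h, finrank_top] at this
    omega
  · rw [hab]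
    refine Submodule.add_mem_sup (Submodule.smul_mem _ _ ?_) (Submodule.smul_mem _ _ ?_)
    · exact Submodule.mem_comap.2 (Submodule.mem_span_singleton.2 ⟨c₁, e₁.symm⟩)
    · exact Submodule.mem_comap.2 (Submodule.mem_span_singleton.2 ⟨c₂, e₂.symm⟩)

end

section

variable {W : Type*} [NormedAddCommGroup W] [NormedSpace ℝ W]

theorem exists_shear [ProperSpace W] (F : W × ℝ → ℍ[ℝ]) (hF : Continuous F)
    (hom : ∀ (c : ℝ) (v : W × ℝ), 0 ≤ c → F (c • v) = c • F v) (h0 : ∀ v ≠ 0, F v ≠ 0)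
    (hgen : ∀ v₁ v₂ : W × ℝ, v₁ ≠ 0 → v₂ ≠ 0 → (F v₁).im = 0 → (F v₂).im = 0 →
      ∀ a b : ℝ, ((0, 1) : W × ℝ) ≠ a • v₁ + b • v₂) :
    ∃ w : W → ℝ, Continuous w ∧ (∀ (c : ℝ) (y : W), 0 ≤ c → w (c • y) = c * w y) ∧
      ∀ y s, (F (y, s)).im = 0 → (0 < (F (y, s)).re → 0 < s + w y) ∧
        ((F (y, s)).re < 0 → s + w y < 0) := by
  let S : ℝ → Set (W × ℝ) := fun σ =>
    Metric.sphere 0 1 ∩ {v | (F v).im = 0 ∧ 0 ≤ σ * (F v).re}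
  have hS : ∀ σ, IsCompact (S σ) := by
    intro σ
    refine (isCompact_sphere _ _).inter_right (IsClosed.inter ?_ ?_)
    · exact isClosed_eq (Quaternion.continuous_im.comp hF) continuous_const
    · exact isClosed_le continuous_const (continuous_const.mul (Quaternion.continuous_re.comp hF))
  have hne : ∀ σ, ∀ v ∈ S σ, v ≠ 0 := fun σ v hv => by
    rintro rfl
    simpa using hv.1
  have hy : ∀ v : W × ℝ, v ≠ 0 → (F v).im = 0 → v.1 ≠ 0 := by
    rintro ⟨y, s⟩ hv hi hy
    obtain rfl : y = 0 := hy
    have hs : s ≠ 0 := by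
      rintro rfl
      exact hv rfl
    exact hgen _ _ hv hv hi hi s⁻¹ 0 (by simp [hs])
  let pr : W × ℝ → W := fun v => ‖v.1‖⁻¹ • v.1
  have hpr : ∀ σ, ContinuousOn pr (S σ) := by
    intro σ v hv
    have := norm_ne_zero_iff.2 (hy v (hne σ v hv) hv.2.1)
    exact ContinuousAt.continuousWithinAt (by fun_prop (disch := assumption))
  have hK : ∀ σ, IsClosed ((Subtype.val : Metric.sphere (0 : W) 1 → W) ⁻¹' (pr '' S σ)) :=
    fun σ => ((hS σ).image_of_continuousOn (hpr σ)).isClosed.preimage continuous_subtype_val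
  have hd : Disjoint ((Subtype.val : Metric.sphere (0 : W) 1 → W) ⁻¹' (pr '' S 1))
      (Subtype.val ⁻¹' (pr '' S (-1))) := by
    rw [Set.disjoint_left]
    rintro x ⟨⟨y₁, s₁⟩, h₁, e₁⟩ ⟨⟨y₂, s₂⟩, h₂, e₂⟩
    have n₁ := hne _ _ h₁
    have n₂ := hne _ _ h₂
    have m₁ : 0 < ‖y₁‖ := norm_pos_iff.2 (hy _ n₁ h₁.2.1)
    have m₂ : 0 < ‖y₂‖ := norm_pos_iff.2 (hy _ n₂ h₂.2.1)
    have e : y₂ = (‖y₂‖ * ‖y₁‖⁻¹) • y₁ := by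
      have : ‖y₁‖⁻¹ • y₁ = ‖y₂‖⁻¹ • y₂ := e₁.trans e₂.symm
      rw [mul_smul, this, smul_smul, mul_inv_cancel₀ m₂.ne', one_smul]
    set c := ‖y₂‖ * ‖y₁‖⁻¹ with hc
    have hc0 : 0 < c := by positivity
    by_cases hs : s₂ = c * s₁
    · have : ((y₂, s₂) : W × ℝ) = c • (y₁, s₁) := by simp [e, hs]
      have hr := h₂.2.2
      rw [this, hom c _ hc0.le, Quaternion.re_smul] at hr
      have hr' := h₁.2.2
      have : (F (y₁, s₁)).re = 0 := by
        have := mul_nonneg hc0.le (by simpa using hr' : 0 ≤ (F (y₁, s₁)).re)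
        have h3 : c * (F (y₁, s₁)).re = 0 := by
          simp only [smul_eq_mul] at hr
          linarith
        exact (mul_eq_zero.1 h3).resolve_left hc0.ne'
      exact h0 _ n₁ (by rw [← Quaternion.re_add_im (F (y₁, s₁)), this, h₁.2.1]; simp)
    · have hs' : s₂ - c * s₁ ≠ 0 := sub_ne_zero.2 hs
      refine hgen _ _ n₁ n₂ h₁.2.1 h₂.2.1 (-(c / (s₂ - c * s₁))) (s₂ - c * s₁)⁻¹ ?_
      rw [e]
      ext
      · simp [smul_smul, div_eq_inv_mul]
      · simp
        field_simp
        ring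
  obtain ⟨φ, φ0, φ1, -⟩ := exists_continuous_zero_one_of_isClosed (hK 1) (hK (-1)) hd
  obtain ⟨δ, hδ, hδ'⟩ : ∃ δ > 0, ∀ σ ∈ ({1, -1} : Set ℝ), ∀ v ∈ S σ, δ ≤ ‖v.1‖ := by
    have hc : IsCompact (S 1 ∪ S (-1)) := (hS 1).union (hS (-1))
    rcases (S 1 ∪ S (-1)).eq_empty_or_nonempty with he | hn
    · refine ⟨1, one_pos, ?_⟩
      rintro σ (rfl | rfl) v hv
      · exact absurd (Or.inl hv) (Set.eq_empty_iff_forall_notMem.1 he v)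
      · exact absurd (Or.inr hv) (Set.eq_empty_iff_forall_notMem.1 he v)
    · obtain ⟨v₀, hv₀, hmin⟩ := hc.exists_isMinOn hn (f := fun v => ‖v.1‖) (by fun_prop)
      refine ⟨‖v₀.1‖, ?_, ?_⟩
      · rcases hv₀ with h | h <;> exact norm_pos_iff.2 (hy _ (hne _ _ h) h.2.1)
      · rintro σ (rfl | rfl) v hv
        · exact hmin (Or.inl hv)
        · exact hmin (Or.inr hv)
  let u : Unit × Metric.sphere (0 : W) 1 → ℝ := fun p => 2 / δ * (1 - 2 * φ p.2)
  have hu : Continuous u := by fun_prop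
  have hw := fun (c : ℝ) (y : W) (hc : 0 ≤ c) => coneExt_smul u () hc y
  refine ⟨fun y => coneExt u ((), y), (continuous_coneExt u hu).comp (by fun_prop), hw, ?_⟩
  have main : ∀ σ ∈ ({1, -1} : Set ℝ), ∀ v ∈ S σ, 0 < σ * (v.2 + coneExt u ((), v.1)) := by
    intro σ hσ v hv
    have hn := hy v (hne _ _ hv) hv.2.1
    have hb : |v.2| ≤ 1 := by
      have h1 := mem_sphere_zero_iff_norm.1 hv.1
      rw [← Real.norm_eq_abs]
      exact (norm_snd_le v).trans h1.le
    have hd := hδ' σ hσ v hv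
    have hb' := abs_le.1 hb
    have h2 : 2 ≤ ‖v.1‖ * (2 / δ) := by
      have := div_mul_cancel₀ 2 hδ.ne'
      nlinarith [div_pos two_pos hδ]
    rw [coneExt_of_ne u hn]
    rcases hσ with rfl | rfl
    · have : φ ⟨‖v.1‖⁻¹ • v.1, inv_norm_smul_mem_sphere hn⟩ = 0 := φ0 ⟨v, hv, rfl⟩
      simp only [u, this, smul_eq_mul]
      nlinarith
    · have : φ ⟨‖v.1‖⁻¹ • v.1, inv_norm_smul_mem_sphere hn⟩ = 1 := φ1 ⟨v, hv, rfl⟩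
      simp only [u, this, smul_eq_mul]
      nlinarith
  have main' : ∀ σ ∈ ({1, -1} : Set ℝ), ∀ y s, (F (y, s)).im = 0 → 0 < σ * (F (y, s)).re →
      0 < σ * (s + coneExt u ((), y)) := by
    intro σ hσ y s hi hr
    have hv : ((y, s) : W × ℝ) ≠ 0 := by
      intro h
      have := hom 0 0 le_rfl
      rw [zero_smul, zero_smul] at this
      rw [h, this] at hr
      simp at hr
    have hn := norm_pos_iff.2 hv
    have := main σ hσ (‖((y, s) : W × ℝ)‖⁻¹ • (y, s)) ⟨inv_norm_smul_mem_sphere hv, ?_⟩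
    · simp only [Prod.smul_mk] at this
      rw [coneExt_smul u () (by positivity)] at this
      simp only [smul_eq_mul, ← mul_add] at this
      rw [mul_left_comm] at this
      exact pos_of_mul_pos_right this (by positivity)
    · simp only [Set.mem_ofPred_eq]
      rw [hom _ _ (by positivity)]
      refine ⟨by simp [hi], ?_⟩
      rw [Quaternion.re_smul, smul_eq_mul, mul_left_comm]
      positivity
  intro y s hi
  refine ⟨fun hr => ?_, fun hr => ?_⟩
  · simpa using main' 1 (by simp) y s hi (by simpa using hr)
  · have := main' (-1) (by simp) y s hi (by simpa using hr)
    linarith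

end

section

variable {W : Type*} [NormedAddCommGroup W] [NormedSpace ℝ W]

theorem Quaternion.im_add_coe_eq_zero {a : ℍ[ℝ]} {r : ℝ} (h : a.im + (r : ℍ[ℝ]) = 0) :
    a.im = 0 ∧ r = 0 := by
  have hr : r = 0 := by simpa using congrArg QuaternionAlgebra.re h
  subst hr
  simpa using h

theorem convexCombination_pos {t a b : ℝ} (h0 : 0 ≤ t) (h1 : t ≤ 1) (ha : 0 < a) (hb : 0 < b) :
    0 < (1 - t) * a + t * b := by
  rcases h0.eq_or_lt with rfl | h
  · simpa
  · have := mul_pos h hb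
    have := mul_nonneg (sub_nonneg.2 h1) ha.le
    linarith

theorem exists_suspension [ProperSpace W] (F : W × ℝ → ℍ[ℝ]) (hF : Continuous F)
    (hom : ∀ (c : ℝ) (v : W × ℝ), 0 ≤ c → F (c • v) = c • F v) (h0 : ∀ v ≠ 0, F v ≠ 0)
    (hgen : ∀ v₁ v₂ : W × ℝ, v₁ ≠ 0 → v₂ ≠ 0 → (F v₁).im = 0 → (F v₂).im = 0 →
      ∀ a b : ℝ, ((0, 1) : W × ℝ) ≠ a • v₁ + b • v₂) :
    ∃ g : W → ℍ[ℝ], Continuous g ∧ (∀ (c : ℝ) (y : W), 0 ≤ c → g (c • y) = c • g y) ∧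
      (∀ y ≠ 0, g y ≠ 0) ∧ (∀ y, (g y).re = 0) ∧
      NonvanishingHomotopic (fun v : {v : W × ℝ // v ≠ 0} => F v)
        (fun v => g v.1.1 + ((v.1.2 : ℝ) : ℍ[ℝ])) := by
  obtain ⟨w, hw, whom, hs⟩ := exists_shear F hF hom h0 hgen
  have w0 : w 0 = 0 := by simpa using whom 0 0 le_rfl
  have hne : ∀ y s, ((y, s) : W × ℝ) ≠ 0 → ∀ t : ℝ, ((y, s - t * w y) : W × ℝ) ≠ 0 := by
    intro y s h t h'
    obtain ⟨rfl, h2⟩ := Prod.mk_eq_zero.1 h'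
    rw [w0] at h2
    exact h (by simpa using h2)
  have key : ∀ y s, ((y, s) : W × ℝ) ≠ 0 → (F (y, s - w y)).im = 0 →
      0 < (F (y, s - w y)).re ∧ 0 < s ∨ (F (y, s - w y)).re < 0 ∧ s < 0 := by
    intro y s h hi
    have h1 := hs y (s - w y) hi
    rw [sub_add_cancel] at h1
    rcases lt_trichotomy (F (y, s - w y)).re 0 with hr | hr | hr
    · exact Or.inr ⟨hr, h1.2 hr⟩
    · have h2 := h0 _ (hne y s h 1)
      rw [one_mul] at h2
      refine absurd ?_ h2
      rw [← Quaternion.re_add_im (F (y, s - w y)), hi, hr]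
      simp
    · exact Or.inl ⟨hr, h1.1 hr⟩
  have H₁ : NonvanishingHomotopic (fun v : {v : W × ℝ // v ≠ 0} => F v)
      (fun v => F (v.1.1, v.1.2 - w v.1.1)) := by
    have := NonvanishingHomotopic.of_continuous
      (H := fun (t : unitInterval) (v : {v : W × ℝ // v ≠ 0}) => F (v.1.1, v.1.2 - t * w v.1.1))
      (by fun_prop) (fun t v => h0 _ (hne _ _ v.2 _))
    convert this using 2 <;> simp
  have H₂ : NonvanishingHomotopic
      (fun v : {v : W × ℝ // v ≠ 0} => F (v.1.1, v.1.2 - w v.1.1))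
      (fun v => (F (v.1.1, v.1.2 - w v.1.1)).im + ((v.1.2 : ℝ) : ℍ[ℝ])) := by
    have := NonvanishingHomotopic.of_continuous
      (H := fun (t : unitInterval) (v : {v : W × ℝ // v ≠ 0}) =>
        (F (v.1.1, v.1.2 - w v.1.1)).im +
        (((1 - t) * (F (v.1.1, v.1.2 - w v.1.1)).re + t * v.1.2 : ℝ) : ℍ[ℝ])) ?_ ?_
    · convert this using 2
      · simp [add_comm]
      · simp
    · refine (Quaternion.continuous_im.comp (by fun_prop)).add
        (Quaternion.continuous_coe.comp (.add (.mul (by fun_prop)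
          (Quaternion.continuous_re.comp (by fun_prop))) (by fun_prop)))
    · intro t v h
      obtain ⟨hi, hr⟩ := Quaternion.im_add_coe_eq_zero h
      rcases key _ _ v.2 hi with ⟨a, b⟩ | ⟨a, b⟩
      · exact (convexCombination_pos t.2.1 t.2.2 a b).ne' hr
      · have := convexCombination_pos t.2.1 t.2.2 (neg_pos.2 a) (neg_pos.2 b)
        linarith
  have H₃ : NonvanishingHomotopic
      (fun v : {v : W × ℝ // v ≠ 0} => (F (v.1.1, v.1.2 - w v.1.1)).im + ((v.1.2 : ℝ) : ℍ[ℝ]))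
      (fun v => (F (v.1.1, - w v.1.1)).im + ((v.1.2 : ℝ) : ℍ[ℝ])) := by
    have := NonvanishingHomotopic.of_continuous
      (H := fun (t : unitInterval) (v : {v : W × ℝ // v ≠ 0}) =>
        (F (v.1.1, (1 - t) * v.1.2 - w v.1.1)).im + ((v.1.2 : ℝ) : ℍ[ℝ])) ?_ ?_
    · convert this using 2 <;> simp
    · exact (Quaternion.continuous_im.comp (by fun_prop)).add
        (Quaternion.continuous_coe.comp (by fun_prop))
    · intro t v h
      obtain ⟨hi, hr⟩ := Quaternion.im_add_coe_eq_zero h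
      have hv := v.2
      rw [hr, mul_zero] at hi
      rcases key v.1.1 0 (by rwa [← hr]) hi with ⟨a, b⟩ | ⟨a, b⟩ <;> exact lt_irrefl _ b
  refine ⟨fun y => (F (y, -w y)).im, Quaternion.continuous_im.comp (by fun_prop), ?_, ?_, ?_,
    H₁.trans (H₂.trans H₃)⟩
  · intro c y hc
    have : ((c • y, - w (c • y)) : W × ℝ) = c • (y, - w y) := by simp [whom c y hc]
    change (F (c • y, -w (c • y))).im = _
    rw [this, hom c _ hc, Quaternion.im_smul]
  · intro y hy h
    have := key y 0 (by simp [hy]) (by simpa using h)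
    simp at this
  · simp

end

theorem Quaternion.re_eq_zero_of_mul_self_eq_neg_one {b : ℍ[ℝ]} (hb : b * b = -1) : b.re = 0 := by
  have h0 := congrArg QuaternionAlgebra.re hb
  have h1 := congrArg QuaternionAlgebra.imI hb
  have h2 := congrArg QuaternionAlgebra.imJ hb
  have h3 := congrArg QuaternionAlgebra.imK hb
  simp at h0 h1 h2 h3
  by_contra h
  have e1 : b.imI = 0 := by
    have : b.re * b.imI = 0 := by linarith
    exact (mul_eq_zero.1 this).resolve_left h
  have e2 : b.imJ = 0 := by
    have : b.re * b.imJ = 0 := by linarith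
    exact (mul_eq_zero.1 this).resolve_left h
  have e3 : b.imK = 0 := by
    have : b.re * b.imK = 0 := by linarith
    exact (mul_eq_zero.1 this).resolve_left h
  rw [e1, e2, e3] at h0
  nlinarith [mul_self_nonneg b.re]

theorem conj_quatI_mul_self {a : ℍ[ℝ]} (ha : a ≠ 0) :
    (a * quatI * a⁻¹) * (a * quatI * a⁻¹) = -1 := by
  calc (a * quatI * a⁻¹) * (a * quatI * a⁻¹) = a * quatI * (a⁻¹ * a) * quatI * a⁻¹ := by
        simp only [mul_assoc]
    _ = a * (quatI * quatI) * a⁻¹ := by rw [inv_mul_cancel₀ ha, mul_one, mul_assoc a]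
    _ = -1 := by rw [quatI_mul_self, mul_neg, mul_one, neg_mul, mul_inv_cancel₀ ha]

theorem Quaternion.joined_nonzero (a b : {q : ℍ[ℝ] // q ≠ 0}) : Joined a b := by
  have h : IsPathConnected ({0}ᶜ : Set ℍ[ℝ]) := by
    refine isPathConnected_compl_singleton_of_one_lt_rank ?_ 0
    rw [Quaternion.rank_eq_four]
    norm_num
  have := isPathConnected_iff_pathConnectedSpace.1 h
  exact PathConnectedSpace.joined (X := ({0}ᶜ : Set ℍ[ℝ])) a b

/-- The suspension of a purely imaginary map on a three-sphere is homotopic to its conjugate. -/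
theorem nonvanishingHomotopic_neg_of_suspension (g : (ℂ × ℝ) × ℝ → ℍ[ℝ]) (hg : Continuous g)
    (hom : ∀ (c : ℝ) (y : (ℂ × ℝ) × ℝ), 0 ≤ c → g (c • y) = c • g y) (h0 : ∀ y ≠ 0, g y ≠ 0)
    (hre : ∀ y, (g y).re = 0) :
    NonvanishingHomotopic
      (fun v : {v : ((ℂ × ℝ) × ℝ) × ℝ // v ≠ 0} => g v.1.1 + ((v.1.2 : ℝ) : ℍ[ℝ]))
      (fun v => -g v.1.1 + ((v.1.2 : ℝ) : ℍ[ℝ])) := by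
  have hsq : ∀ y, g y * g y = -(((‖g y‖ * ‖g y‖ : ℝ)) : ℍ[ℝ]) := by
    intro y
    have hstar : star (g y) = -g y := by
      ext <;> simp [hre y]
    rw [← Quaternion.normSq_eq_norm_mul_self, ← Quaternion.self_mul_star, hstar, mul_neg, neg_neg]
  have hx : ∀ x : Metric.sphere (0 : (ℂ × ℝ) × ℝ) 1, ‖g x‖ ≠ 0 := fun x =>
    norm_ne_zero_iff.2 (h0 _ (ne_zero_of_mem_unit_sphere x))
  let b : C(Metric.sphere (0 : (ℂ × ℝ) × ℝ) 1, {b : ℍ[ℝ] // b * b = -1}) :=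
    ⟨fun x => ⟨‖g x‖⁻¹ • g x, by
      have := hx x
      rw [smul_mul_smul_comm, hsq, smul_neg, ← Quaternion.coe_smul, smul_eq_mul]
      field_simp
      simp⟩, by
      refine Continuous.subtype_mk ?_ _
      fun_prop (disch := assumption)⟩
  obtain ⟨q, hq⟩ := exists_hopf_lift b
  obtain ⟨γ⟩ := Quaternion.joined_nonzero ⟨1, one_ne_zero⟩
    ⟨quatJ, norm_ne_zero_iff.1 (by simp [norm_quatJ])⟩
  have hqγ : ∀ (t : unitInterval) x, q x * (γ t : ℍ[ℝ]) ≠ 0 := fun t x =>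
    mul_ne_zero (hq x).1 (γ t).2
  let u : unitInterval × Metric.sphere (0 : (ℂ × ℝ) × ℝ) 1 → ℍ[ℝ] := fun p =>
    ‖g p.2‖ • ((q p.2 * γ p.1) * quatI * (q p.2 * γ p.1)⁻¹)
  have hu : Continuous u := by
    have hc : Continuous fun p : unitInterval × Metric.sphere (0 : (ℂ × ℝ) × ℝ) 1 =>
      q p.2 * (γ p.1 : ℍ[ℝ]) := by fun_prop
    exact ((hg.comp (by fun_prop)).norm).smul
      ((hc.mul continuous_const).mul (hc.inv₀ fun p => hqγ p.1 p.2))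
  have hcr : ∀ t y, (coneExt u (t, y)).re = 0 := by
    intro t y
    by_cases hy : y = 0
    · simp [hy, coneExt_zero]
    · rw [coneExt_of_ne u hy]
      simp only [u, Quaternion.re_smul,
        Quaternion.re_eq_zero_of_mul_self_eq_neg_one (conj_quatI_mul_self (hqγ _ _)), smul_zero]
  have hc0 : ∀ t y, coneExt u (t, y) = 0 → y = 0 := by
    intro t y h
    by_contra hy
    rw [coneExt_of_ne u hy] at h
    have hI : quatI ≠ 0 := norm_ne_zero_iff.1 (by simp [norm_quatI])
    refine smul_ne_zero (norm_ne_zero_iff.2 hy) (smul_ne_zero (hx _) ?_) h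
    exact mul_ne_zero (mul_ne_zero (hqγ _ _) hI) (inv_ne_zero (hqγ _ _))
  have hcone : ∀ (σ : ℝ) t, (∀ x, u (t, x) = σ • g x) → ∀ y, coneExt u (t, y) = σ • g y := by
    intro σ t h y
    by_cases hy : y = 0
    · have := hom 0 0 le_rfl
      rw [zero_smul, zero_smul] at this
      rw [hy, coneExt_zero, this, smul_zero]
    · rw [coneExt_of_ne u hy, h, smul_comm, ← hom _ _ (norm_nonneg y)]
      simp [smul_smul, hy]
  have hb : ∀ x : Metric.sphere (0 : (ℂ × ℝ) × ℝ) 1, ‖g x‖ • (q x * quatI * (q x)⁻¹) = g x := by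
    intro x
    rw [← (hq x).2, mul_assoc, mul_inv_cancel₀ (hq x).1, mul_one]
    simp [b, smul_smul, hx x]
  have u0 : ∀ x, u (0, x) = (1 : ℝ) • g x := by
    intro x
    simp only [u, γ.source, mul_one, one_smul]
    exact hb x
  have u1 : ∀ x, u (1, x) = (-1 : ℝ) • g x := by
    intro x
    have hJ : quatJ ≠ 0 := norm_ne_zero_iff.1 (by simp [norm_quatJ])
    have hJI : quatJ * quatI * quatJ⁻¹ = -quatI := by
      rw [quatJ_mul_quatI, ← quatI_mul_quatJ, neg_mul, mul_assoc, mul_inv_cancel₀ hJ, mul_one]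
    have : q x * quatJ * quatI * (q x * quatJ)⁻¹ = -(q x * quatI * (q x)⁻¹) := by
      rw [_root_.mul_inv_rev]
      calc _ = q x * (quatJ * quatI * quatJ⁻¹) * (q x)⁻¹ := by simp only [mul_assoc]
        _ = _ := by rw [hJI, mul_neg, neg_mul]
    simp only [u, γ.target, this, smul_neg, hb x, neg_smul, one_smul]
  have := NonvanishingHomotopic.of_continuous
    (H := fun (t : unitInterval) (v : {v : ((ℂ × ℝ) × ℝ) × ℝ // v ≠ 0}) =>
      coneExt u (t, v.1.1) + ((v.1.2 : ℝ) : ℍ[ℝ])) ?_ ?_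
  · simpa only [hcone _ _ u0, hcone _ _ u1, one_smul, neg_smul] using this
  · exact ((continuous_coneExt u hu).comp (by fun_prop)).add
      (Quaternion.continuous_coe.comp (by fun_prop))
  · intro t v h
    have hs : v.1.2 = 0 := by simpa [hcr] using congrArg QuaternionAlgebra.re h
    rw [hs] at h
    exact v.2 (Prod.ext (hc0 t _ (by simpa using h)) hs)

theorem nonvanishingHomotopic_of_norm_sub_lt {X E : Type*} [TopologicalSpace X]
    [NormedAddCommGroup E] [NormedSpace ℝ E] {f g : X → E} (hf : Continuous f) (hg : Continuous g)
    (h : ∀ x, ‖g x - f x‖ < ‖f x‖) : NonvanishingHomotopic f g := by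
  have := NonvanishingHomotopic.of_continuous
    (H := fun (t : unitInterval) x => f x + (t : ℝ) • (g x - f x)) (by fun_prop) ?_
  · convert this using 2 <;> simp
  · intro t x h0
    have h1 : ‖f x‖ = ‖(t : ℝ) • (g x - f x)‖ := by
      simpa using congrArg norm (eq_neg_of_add_eq_zero_left h0)
    rw [norm_smul, Real.norm_of_nonneg t.2.1] at h1
    have := mul_le_of_le_one_left (norm_nonneg (g x - f x)) t.2.2
    exact absurd (h x) (by linarith)

theorem nonvanishingHomotopic_star {X : Type*} [TopologicalSpace X] {f g : X → ℍ[ℝ]}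
    (h : NonvanishingHomotopic f g) :
    NonvanishingHomotopic (fun x => star (f x)) fun x => star (g x) :=
  h.postcomp star continuous_star fun _ => star_ne_zero.2

/-- A nowhere vanishing quaternion valued map on the four-sphere is homotopic to its conjugate. -/
theorem nonvanishingHomotopic_star_self
    (f : C(Metric.sphere (0 : ((ℂ × ℝ) × ℝ) × ℝ) 1, ℍ[ℝ])) (hf : ∀ x, f x ≠ 0) :
    NonvanishingHomotopic f fun x => star (f x) := by
  obtain ⟨x₀, -, hx₀⟩ := isCompact_univ.exists_isMinOn
    (s := (Set.univ : Set (Metric.sphere (0 : ((ℂ × ℝ) × ℝ) × ℝ) 1)))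
    ⟨⟨(0, 1), by simp [Prod.norm_def]⟩, trivial⟩ (f := fun x => ‖f x‖) (by fun_prop)
  obtain ⟨G, hG, hom, ⟨T, hT⟩, hGf⟩ := exists_piecewise_linear_approx f (norm_pos_iff.2 (hf x₀))
  have hlt : ∀ x : Metric.sphere (0 : ((ℂ × ℝ) × ℝ) × ℝ) 1, ‖G x - f x‖ < ‖f x‖ :=
    fun x => (hGf x).trans_le (hx₀ (Set.mem_univ x))
  have hfG : NonvanishingHomotopic f (fun x => G x) :=
    nonvanishingHomotopic_of_norm_sub_lt f.continuous (by fun_prop) hlt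
  have hG0 : ∀ v ≠ 0, G v ≠ 0 := by
    intro v hv h
    have := hlt ⟨‖v‖⁻¹ • v, inv_norm_smul_mem_sphere hv⟩
    simp only [hom _ v (inv_nonneg.2 (norm_nonneg v)), h, smul_zero, zero_sub, norm_neg] at this
    exact lt_irrefl _ this
  obtain ⟨p, hp, v, hv, hgen⟩ := exists_generic (V := ((ℂ × ℝ) × ℝ) × ℝ)
    (by simp [Module.finrank_prod]) T
  obtain ⟨A, hA⟩ := SeparatingDual.exists_continuousLinearEquiv_apply_eq (R := ℝ)
    (x := ((0, 1) : ((ℂ × ℝ) × ℝ) × ℝ)) (by simp) hv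
  let F : ((ℂ × ℝ) × ℝ) × ℝ → ℍ[ℝ] := fun w => G (A w) * p⁻¹
  have hF0 : ∀ w ≠ 0, F w ≠ 0 := fun w hw =>
    mul_ne_zero (hG0 _ (A.map_ne_zero_iff.2 hw)) (inv_ne_zero hp)
  have hFim : ∀ w ≠ 0, (F w).im = 0 → (F w).re ≠ 0 ∧ G (A w) = (F w).re • p := by
    intro w hw hi
    have e : F w = ((F w).re : ℍ[ℝ]) := by
      conv_lhs => rw [← Quaternion.re_add_im (F w), hi, add_zero]
    refine ⟨fun h => hF0 w hw (by rw [e, h]; simp), ?_⟩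
    rw [← Quaternion.coe_mul_eq_smul, ← e, inv_mul_cancel_right₀ hp]
  obtain ⟨g, hg, ghom, g0, gre, H⟩ := exists_suspension F
    ((hG.comp A.continuous).mul continuous_const)
    (fun c w hc => by simp only [F, map_smul, hom c _ hc, smul_mul_assoc]) hF0 (by
      intro v₁ v₂ n₁ n₂ i₁ i₂ a b hab
      obtain ⟨r₁, e₁⟩ := hFim v₁ n₁ i₁
      obtain ⟨r₂, e₂⟩ := hFim v₂ n₂ i₂
      obtain ⟨L₁, m₁, l₁⟩ := hT (A v₁) (A.map_ne_zero_iff.2 n₁)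
      obtain ⟨L₂, m₂, l₂⟩ := hT (A v₂) (A.map_ne_zero_iff.2 n₂)
      refine hgen L₁ m₁ L₂ m₂ _ _ _ _ r₁ r₂ (l₁ ▸ e₁) (l₂ ▸ e₂) a b ?_
      rw [← hA, hab, map_add, map_smul, map_smul])
  have hneg := nonvanishingHomotopic_neg_of_suspension g hg ghom g0 gre
  have hstar : (fun w : {w : ((ℂ × ℝ) × ℝ) × ℝ // w ≠ 0} =>
      -g w.1.1 + ((w.1.2 : ℝ) : ℍ[ℝ])) = fun w => star (g w.1.1 + ((w.1.2 : ℝ) : ℍ[ℝ])) := by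
    funext w
    ext <;> simp [gre]
  rw [hstar] at hneg
  let k : C(Metric.sphere (0 : ((ℂ × ℝ) × ℝ) × ℝ) 1, {w : ((ℂ × ℝ) × ℝ) × ℝ // w ≠ 0}) :=
    ⟨fun x => ⟨A.symm x, A.symm.map_ne_zero_iff.2 (ne_zero_of_mem_unit_sphere x)⟩, by fun_prop⟩
  have hFF := ((H.trans hneg).trans (nonvanishingHomotopic_star H).symm).precomp k
  have hGp : NonvanishingHomotopic
      (fun x : Metric.sphere (0 : ((ℂ × ℝ) × ℝ) × ℝ) 1 => G x) (fun x => G x * p⁻¹) := by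
    obtain ⟨γ⟩ := Quaternion.joined_nonzero ⟨1, one_ne_zero⟩ ⟨p⁻¹, inv_ne_zero hp⟩
    have := NonvanishingHomotopic.of_continuous
      (H := fun (t : unitInterval) (x : Metric.sphere (0 : ((ℂ × ℝ) × ℝ) × ℝ) 1) =>
        G x * (γ t : ℍ[ℝ])) (by fun_prop)
      fun t x => mul_ne_zero (hG0 _ (ne_zero_of_mem_unit_sphere x)) (γ t).2
    simpa using this
  have hkk : NonvanishingHomotopic
      (fun x : Metric.sphere (0 : ((ℂ × ℝ) × ℝ) × ℝ) 1 => G x * p⁻¹)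
      (fun x => star (G x * p⁻¹)) := by
    convert hFF using 2 <;> simp [F, k]
  have hfp := hfG.trans hGp
  exact hfp.trans (hkk.trans (nonvanishingHomotopic_star hfp).symm)

theorem exists_unit_homotopy_star
    (q : C(Metric.sphere (0 : ((ℂ × ℝ) × ℝ) × ℝ) 1, ℍ[ℝ])) (hq : ∀ x, ‖q x‖ = 1) :
    ∃ H : C(unitInterval × Metric.sphere (0 : ((ℂ × ℝ) × ℝ) × ℝ) 1, ℍ[ℝ]),
      (∀ z, ‖H z‖ = 1) ∧ (∀ x, H (0, x) = q x) ∧ ∀ x, H (1, x) = star (q x) := by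
  obtain ⟨f, g, hf, hg, ⟨H⟩⟩ := nonvanishingHomotopic_star_self q
    fun x => norm_ne_zero_iff.1 (by simp [hq])
  refine ⟨⟨fun z => ‖(H z : ℍ[ℝ])‖⁻¹ • (H z : ℍ[ℝ]), ?_⟩, fun z => ?_, fun x => ?_, fun x => ?_⟩
  · have : ∀ z, ‖(H z : ℍ[ℝ])‖ ≠ 0 := fun z => norm_ne_zero_iff.2 (H z).2
    fun_prop (disch := assumption)
  · exact mem_sphere_zero_iff_norm.1 (inv_norm_smul_mem_sphere (H z).2)
  · simp [hf, hq]
  · simp [hg, hq]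

/-- Left multiplication by a quaternion on `ℍ × ℝ`, in the basis `i, j, k, 1` of `ℍ`. -/
def mulLeftMat (a : ℍ[ℝ]) : Matrix (Fin 5) (Fin 5) ℝ :=
  !![a.re, -a.imK, a.imJ, a.imI, 0;
    a.imK, a.re, -a.imI, a.imJ, 0;
    -a.imJ, a.imI, a.re, a.imK, 0;
    -a.imI, -a.imJ, -a.imK, a.re, 0;
    0, 0, 0, 0, 1]

/-- Right multiplication by a quaternion on `ℍ × ℝ`, in the basis `i, j, k, 1` of `ℍ`. -/
def mulRightMat (b : ℍ[ℝ]) : Matrix (Fin 5) (Fin 5) ℝ :=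
  !![b.re, b.imK, -b.imJ, b.imI, 0;
    -b.imK, b.re, b.imI, b.imJ, 0;
    b.imJ, -b.imI, b.re, b.imK, 0;
    -b.imI, -b.imJ, -b.imK, b.re, 0;
    0, 0, 0, 0, 1]

/-- A path of rotations from the identity to `diag(-1, -1, -1, 1, -1)`. -/
noncomputable def conjPath (t : ℝ) : Matrix (Fin 5) (Fin 5) ℝ :=
  !![Real.cos (Real.pi * t), -Real.sin (Real.pi * t), 0, 0, 0;
    Real.sin (Real.pi * t), Real.cos (Real.pi * t), 0, 0, 0;
    0, 0, Real.cos (Real.pi * t), 0, -Real.sin (Real.pi * t);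
    0, 0, 0, 1, 0;
    0, 0, Real.sin (Real.pi * t), 0, Real.cos (Real.pi * t)]

theorem Quaternion.sq_add_eq_one_of_norm {a : ℍ[ℝ]} (ha : ‖a‖ = 1) :
    a.re * a.re + a.imI * a.imI + a.imJ * a.imJ + a.imK * a.imK = 1 := by
  have h := Quaternion.normSq_eq_norm_mul_self a
  rw [ha, Quaternion.normSq_def'] at h
  linarith

theorem mulLeftMat_orthogonal {a : ℍ[ℝ]} (ha : ‖a‖ = 1) :
    (mulLeftMat a)ᵀ * mulLeftMat a = 1 := by
  have h := Quaternion.sq_add_eq_one_of_norm ha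
  ext i j
  fin_cases i <;> fin_cases j <;>
    simp [mulLeftMat, Matrix.mul_apply, Fin.sum_univ_five] <;> linarith

theorem mulRightMat_orthogonal {b : ℍ[ℝ]} (hb : ‖b‖ = 1) :
    (mulRightMat b)ᵀ * mulRightMat b = 1 := by
  have h := Quaternion.sq_add_eq_one_of_norm hb
  ext i j
  fin_cases i <;> fin_cases j <;>
    simp [mulRightMat, Matrix.mul_apply, Fin.sum_univ_five] <;> linarith

theorem conjPath_orthogonal (t : ℝ) : (conjPath t)ᵀ * conjPath t = 1 := by
  have h := Real.sin_sq_add_cos_sq (Real.pi * t)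
  ext i j
  fin_cases i <;> fin_cases j <;>
    simp [conjPath, Matrix.mul_apply, Fin.sum_univ_five] <;> linarith

theorem conjPath_zero : conjPath 0 = 1 := by
  ext i j
  fin_cases i <;> fin_cases j <;> simp [conjPath]

theorem conjPath_one : conjPath 1 = Matrix.diagonal ![-1, -1, -1, 1, -1] := by
  ext i j
  fin_cases i <;> fin_cases j <;> simp [conjPath]

theorem conjPath_one_mul_mul {a : ℍ[ℝ]} (ha : ‖a‖ = 1) :
    conjPath 1 * mulLeftMat a * (conjPath 1)ᵀ * mulRightMat a = 1 := by
  have h := Quaternion.sq_add_eq_one_of_norm ha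
  rw [conjPath_one, Matrix.diagonal_transpose]
  ext i j
  rw [Matrix.mul_apply]
  simp only [Matrix.mul_diagonal, Matrix.diagonal_mul]
  fin_cases i <;> fin_cases j <;>
    simp [mulLeftMat, mulRightMat, Fin.sum_univ_five] <;> linarith

theorem ist_eq_mulLeftMat_mul_mulRightMat {q : ℍ[ℝ]} {A : Matrix (Fin 3) (Fin 3) ℝ}
    (hq : ‖q‖ = 1) (h : QuatLifts q A) : ist A = mulLeftMat q * mulRightMat (star q) := by
  have hs := Quaternion.sq_add_eq_one_of_norm hq
  have hqq : q * star q = 1 := by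
    rw [Quaternion.self_mul_star, Quaternion.normSq_eq_norm_mul_self, hq]
    simp
  have hc : ∀ b c : ℍ[ℝ], b * q = q * c → b = q * c * star q := by
    intro b c e
    rw [← e, mul_assoc, hqq, mul_one]
  obtain ⟨-, h0, h1, h2⟩ := h
  have e0 := hc _ _ h0
  have e1 := hc _ _ h1
  have e2 := hc _ _ h2
  have a00 := congrArg QuaternionAlgebra.imI e0
  have a10 := congrArg QuaternionAlgebra.imJ e0
  have a20 := congrArg QuaternionAlgebra.imK e0
  have a01 := congrArg QuaternionAlgebra.imI e1
  have a11 := congrArg QuaternionAlgebra.imJ e1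
  have a21 := congrArg QuaternionAlgebra.imK e1
  have a02 := congrArg QuaternionAlgebra.imI e2
  have a12 := congrArg QuaternionAlgebra.imJ e2
  have a22 := congrArg QuaternionAlgebra.imK e2
  simp at a00 a10 a20 a01 a11 a21 a02 a12 a22
  ext i j
  fin_cases i <;> fin_cases j <;>
    simp [ist, mulLeftMat, mulRightMat, Matrix.mul_apply, Fin.sum_univ_five] <;> linarith

section

variable {X : Type*} [TopologicalSpace X]

theorem continuous_mulLeftMat : Continuous mulLeftMat := by
  have h0 := Quaternion.continuous_re
  have h1 := Quaternion.continuous_imI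
  have h2 := Quaternion.continuous_imJ
  have h3 := Quaternion.continuous_imK
  refine continuous_matrix fun i j => ?_
  fin_cases i <;> fin_cases j <;> simp [mulLeftMat] <;> fun_prop

theorem continuous_mulRightMat : Continuous mulRightMat := by
  have h0 := Quaternion.continuous_re
  have h1 := Quaternion.continuous_imI
  have h2 := Quaternion.continuous_imJ
  have h3 := Quaternion.continuous_imK
  refine continuous_matrix fun i j => ?_
  fin_cases i <;> fin_cases j <;> simp [mulRightMat] <;> fun_prop

theorem continuous_conjPath : Continuous conjPath := by
  refine continuous_matrix fun i j => ?_
  fin_cases i <;> fin_cases j <;> simp [conjPath] <;> fun_prop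

/-- A homotopy through orthogonal matrices starting in `SO(n)` stays in `SO(n)`. -/
theorem SO_homotopic_of_orthogonal {n : ℕ} (K : C(unitInterval × X, Matrix (Fin n) (Fin n) ℝ))
    (hK : ∀ z, (K z)ᵀ * K z = 1) (g : C(X, SO n)) (h0 : ∀ x, K (0, x) = (g x).1) :
    ∃ g' : C(X, SO n), (∀ x, (g' x).1 = K (1, x)) ∧ g.Homotopic g' := by
  have hsq : ∀ z, (K z).det * (K z).det = 1 := fun z => by
    simpa using congrArg Matrix.det (hK z)
  have hdet : ∀ z, (K z).det = 1 := by
    rintro ⟨t, x⟩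
    by_contra hne
    have hneg : (K (t, x)).det = -1 := (mul_self_eq_one_iff.1 (hsq _)).resolve_left hne
    obtain ⟨s, hs⟩ := mem_range_of_exists_le_of_exists_ge (c := (0 : ℝ))
      (f := fun s : unitInterval => (K (s, x)).det) (by fun_prop) ⟨t, by simp [hneg]⟩
      ⟨0, by simp [h0, (g x).2.2]⟩
    have := hsq (s, x)
    simp only at hs
    simp [hs] at this
  refine ⟨⟨fun x => ⟨K (1, x), hK _, hdet _⟩, by fun_prop⟩, fun _ => rfl,
    ⟨⟨⟨fun z => ⟨K z, hK z, hdet z⟩, by fun_prop⟩, fun x => Subtype.ext (h0 x), fun _ => rfl⟩⟩⟩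

theorem orthogonal_mul {n : ℕ} {A B : Matrix (Fin n) (Fin n) ℝ} (hA : Aᵀ * A = 1)
    (hB : Bᵀ * B = 1) : (A * B)ᵀ * (A * B) = 1 := by
  rw [Matrix.transpose_mul, mul_assoc, ← mul_assoc Aᵀ, hA, one_mul, hB]

theorem orthogonal_transpose {n : ℕ} {A : Matrix (Fin n) (Fin n) ℝ} (hA : Aᵀ * A = 1) :
    Aᵀᵀ * Aᵀ = 1 := by
  rw [Matrix.transpose_transpose]
  exact mul_eq_one_comm.1 hA

/-- `ist` composed with conjugation by `q` contracts when `q` is homotopic to its conjugate. -/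
theorem ist_homotopic_const_of_unit_homotopy {q : X → ℍ[ℝ]} (f : X → SO 3)
    (hq : ∀ x, QuatLifts (q x) (f x).1) (H : C(unitInterval × X, ℍ[ℝ])) (hH : ∀ z, ‖H z‖ = 1)
    (H0 : ∀ x, H (0, x) = q x) (H1 : ∀ x, H (1, x) = star (q x)) (g : C(X, SO 5))
    (hg : ∀ x, (g x).1 = ist (f x).1) :
    g.Homotopic (.const X ⟨1, by simp⟩) := by
  have hqn : ∀ x, ‖q x‖ = 1 := fun x => H0 x ▸ hH _
  have hqc : Continuous q := by
    have : q = fun x => H (0, x) := funext fun x => (H0 x).symm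
    rw [this]
    fun_prop
  have hL := continuous_mulLeftMat
  have hR := continuous_mulRightMat
  have hC := continuous_conjPath
  obtain ⟨g₁, e₁, h₁⟩ := SO_homotopic_of_orthogonal
    ⟨fun z : unitInterval × X => mulLeftMat (q z.2) * mulRightMat (star (H z)), by fun_prop⟩
    (fun z => orthogonal_mul (mulLeftMat_orthogonal (hqn _))
      (mulRightMat_orthogonal (by rw [norm_star, hH]))) g
    (fun x => by simp [H0, hg, ist_eq_mulLeftMat_mul_mulRightMat (hqn x) (hq x)])
  obtain ⟨g₂, e₂, h₂⟩ := SO_homotopic_of_orthogonal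
    ⟨fun z : unitInterval × X => conjPath z.1 * mulLeftMat (q z.2) * (conjPath z.1)ᵀ *
      mulRightMat (q z.2), by fun_prop⟩
    (fun z => orthogonal_mul (orthogonal_mul (orthogonal_mul (conjPath_orthogonal _)
      (mulLeftMat_orthogonal (hqn _))) (orthogonal_transpose (conjPath_orthogonal _)))
      (mulRightMat_orthogonal (hqn _))) g₁
    (fun x => by simp [e₁, H1, conjPath_zero])
  have : g₂ = .const X ⟨1, by simp⟩ := by
    ext1 x
    refine Subtype.ext ((e₂ x).trans ?_)
    exact conjPath_one_mul_mul (hqn x)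
  exact this ▸ h₁.trans h₂

end

/-- The homomorphism `π₄(SO(3)) → π₄(SO(5))` induced by the standard embedding is
trivial: for every continuous `f : S⁴ → SO(3)`, the composition `i_st ∘ f` (i.e. any
continuous map `g : S⁴ → SO(5)` whose values are `ist (f x)`) is null-homotopic. -/
theorem ist_comp_nullhomotopic (f : C(S4, SO 3)) (g : C(S4, SO 5))
    (hg : ∀ x : S4, (g x).val = ist (f x).val) :
    ∃ y : SO 5, ContinuousMap.Homotopic g (ContinuousMap.const S4 y) := by
  let e : EuclideanSpace ℝ (Fin 5) ≃L[ℝ] ((ℂ × ℝ) × ℝ) × ℝ :=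
    ContinuousLinearEquiv.ofFinrankEq (by simp [Module.finrank_prod])
  have he : ∀ x : S4, e x ≠ 0 := fun x => e.map_ne_zero_iff.2 (ne_zero_of_mem_unit_sphere x)
  have he' : ∀ x : Metric.sphere (0 : ((ℂ × ℝ) × ℝ) × ℝ) 1, e.symm x ≠ 0 := fun x =>
    e.symm.map_ne_zero_iff.2 (ne_zero_of_mem_unit_sphere x)
  let a : C(S4, Metric.sphere (0 : ((ℂ × ℝ) × ℝ) × ℝ) 1) := toSphere ⟨fun x => e x, by fun_prop⟩ he
  let b : C(Metric.sphere (0 : ((ℂ × ℝ) × ℝ) × ℝ) 1, S4) :=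
    toSphere ⟨fun x => e.symm x, by fun_prop⟩ he'
  have hba : ∀ x, b (a x) = x := by
    intro x
    have hn : ‖e x‖ ≠ 0 := norm_ne_zero_iff.2 (he x)
    ext1
    simp [a, b, toSphere, norm_smul, smul_smul, hn]
  obtain ⟨q, hq⟩ := exists_unit_quaternion_lift (V := (ℂ × ℝ) × ℝ)
    (Module.lt_rank_of_lt_finrank (by simp [Module.finrank_prod])) (f.comp b)
  obtain ⟨H, hH, H0, H1⟩ := exists_unit_homotopy_star q fun x => (hq x).1
  have h := ist_homotopic_const_of_unit_homotopy (q := q) (f.comp b) (fun x => (hq x).2) H hH H0 H1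
    (g.comp b) fun x => hg _
  have hg' : (g.comp b).comp a = g := by
    ext1 x
    simp [hba]
  exact ⟨⟨1, by simp⟩, hg' ▸ h.comp (ContinuousMap.Homotopic.refl a)⟩
end
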